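/- arXiv:1612.03074 — 10 statements merged into one kernel-verified Lean document; each statement's English description precedes it below -/
import Mathlib

section
/- For every pair of positive integers c and d, there exists a unique sequence of integers k_d > k_{d-1} > \cdots > k_1 \ge 0 such that c = \binom{k_d}{d} + \binom{k_{d-1}}{d-1} + \cdots + \binom{k_1}{1} (with the convention that \binom{a}{b} = 0 when a < b). This expression is called the d-th Macaulay representation (binomial expansion in base d) of c. -/
/-- A Macaulay sum of length `d` with all entries below `m` is smaller than `C(m, d)`. -/
theorem sum_choose_lt_choose_of_strictMono {d : ℕ} {k : Fin d → ℕ} (hk : StrictMono k) {m : ℕ}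
    (hm : ∀ i, k i < m) : ∑ i : Fin d, Nat.choose (k i) (i.1 + 1) < Nat.choose m d := by
  induction d generalizing m with
  | zero => simp
  | succ d ih =>
    have hlt := ih (k := fun i => k i.castSucc) (fun i j h => hk (Fin.castSucc_lt_castSucc_iff.2 h))
      (m := k (Fin.last d)) (fun i => hk (Fin.castSucc_lt_last i))
    have hle : Nat.choose (k (Fin.last d) + 1) (d + 1) ≤ Nat.choose m (d + 1) :=
      Nat.choose_le_choose _ (hm _)
    rw [Nat.choose_succ_succ'] at hle
    rw [Fin.sum_univ_castSucc]
    simp only [Fin.val_castSucc, Fin.val_last] at hlt ⊢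
    omega

/-- The largest entry of a strictly increasing sequence is monotone in its Macaulay sum. -/
theorem last_le_last_of_sum_choose_le {d : ℕ} {k l : Fin (d + 1) → ℕ} (hk : StrictMono k)
    (h : ∑ i, Nat.choose (l i) (i.1 + 1) ≤ ∑ i, Nat.choose (k i) (i.1 + 1)) :
    l (Fin.last d) ≤ k (Fin.last d) := by
  by_contra! hlt
  have h₁ := sum_choose_lt_choose_of_strictMono hk (m := l (Fin.last d))
    (fun i => (hk.monotone (Fin.le_last i)).trans_lt hlt)
  have h₂ := Finset.single_le_sum (f := fun i : Fin (d + 1) => Nat.choose (l i) (i.1 + 1))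
    (fun _ _ => Nat.zero_le _) (Finset.mem_univ (Fin.last d))
  simp only [Fin.val_last] at h₂
  omega

/-- A strictly increasing sequence is determined by its Macaulay sum. -/
theorem eq_of_sum_choose_eq {d : ℕ} {k l : Fin d → ℕ} (hk : StrictMono k) (hl : StrictMono l)
    (h : ∑ i, Nat.choose (k i) (i.1 + 1) = ∑ i, Nat.choose (l i) (i.1 + 1)) : k = l := by
  induction d with
  | zero => exact Subsingleton.elim _ _
  | succ d ih =>
    have hlast : k (Fin.last d) = l (Fin.last d) :=
      le_antisymm (last_le_last_of_sum_choose_le hl h.le) (last_le_last_of_sum_choose_le hk h.ge)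
    rw [Fin.sum_univ_castSucc, Fin.sum_univ_castSucc, hlast, Nat.add_right_cancel_iff] at h
    have hinit := ih (k := fun i => k i.castSucc) (l := fun i => l i.castSucc)
      (fun i j hij => hk (Fin.castSucc_lt_castSucc_iff.2 hij))
      (fun i j hij => hl (Fin.castSucc_lt_castSucc_iff.2 hij)) h
    funext i
    induction i using Fin.lastCases with
    | last => exact hlast
    | cast i => exact congrFun hinit i

/-- Every `c < C(m, d)` is a Macaulay sum of length `d` with all entries below `m`. -/
theorem exists_strictMono_sum_choose_eq (d m c : ℕ) (hc : c < Nat.choose m d) :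
    ∃ k : Fin d → ℕ, StrictMono k ∧ (∀ i, k i < m) ∧
      c = ∑ i : Fin d, Nat.choose (k i) (i.1 + 1) := by
  induction d generalizing m c with
  | zero =>
    exact ⟨Fin.elim0, fun i => i.elim0, fun i => i.elim0, by simpa using hc⟩
  | succ d ihd =>
    induction m with
    | zero => simp at hc
    | succ m ihm =>
      by_cases h : c < Nat.choose m (d + 1)
      · obtain ⟨k, hk, hkm, hsum⟩ := ihm h
        exact ⟨k, hk, fun i => (hkm i).trans (Nat.lt_succ_self m), hsum⟩
      · rw [Nat.choose_succ_succ'] at hc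
        obtain ⟨k, hk, hkm, hsum⟩ := ihd m (c - Nat.choose m (d + 1)) (by omega)
        refine ⟨Fin.snoc (α := fun _ => ℕ) k m, ?_, ?_, ?_⟩
        · intro i j hij
          induction j using Fin.lastCases with
          | last =>
            induction i using Fin.lastCases with
            | last => exact absurd hij (lt_irrefl _)
            | cast i => simpa using hkm i
          | cast j =>
            induction i using Fin.lastCases with
            | last => exact absurd hij (Fin.castSucc_lt_last j).not_gt
            | cast i => simpa using hk (Fin.castSucc_lt_castSucc_iff.1 hij)
        · intro i
          induction i using Fin.lastCases with
          | last => simp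
          | cast i => simpa using (hkm i).trans (Nat.lt_succ_self m)
        · rw [Fin.sum_univ_castSucc]
          simp only [Fin.snoc_castSucc, Fin.snoc_last, Fin.val_castSucc, Fin.val_last]
          omega

theorem lt_choose_add_self (c : ℕ) {d : ℕ} (hd : 0 < d) : c < Nat.choose (c + d) d := by
  obtain ⟨e, rfl⟩ := Nat.exists_eq_add_of_lt hd
  induction c with
  | zero => simp
  | succ c ih =>
    have hpos : 0 < Nat.choose (c + (0 + e + 1)) (0 + e) := Nat.choose_pos (by omega)
    rw [Nat.add_right_comm c 1, Nat.choose_succ_succ']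
    omega


/-- **Macaulay representation.** For every pair of positive integers `c` and `d`, there is a
unique sequence of integers `k_d > k_{d-1} > ⋯ > k_1 ≥ 0` such that
`c = C(k_d, d) + C(k_{d-1}, d-1) + ⋯ + C(k_1, 1)`, with the convention that `C(a, b) = 0`
when `a < b`.  Here the sequence is encoded as a strictly monotone function
`k : Fin d → ℕ`, where `k ⟨i, _⟩` is `k_{i+1}`. -/
theorem macaulay_representation_existsUnique (c d : ℕ) (hc : 0 < c) (hd : 0 < d) :
    ∃! k : Fin d → ℕ, StrictMono k ∧ c = ∑ i : Fin d, Nat.choose (k i) (i.1 + 1) := by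
  obtain ⟨k, hk, -, hsum⟩ := exists_strictMono_sum_choose_eq d (c + d) c (lt_choose_add_self c hd)
  exact ⟨k, ⟨hk, hsum⟩, fun l hl => eq_of_sum_choose_eq hl.1 hk (hl.2.symm.trans hsum)⟩
end

section
/- (Macaulay's growth theorem) Let k be a field, S = k[x_0, ..., x_n] the polynomial ring with S_d its space of homogeneous polynomials of degree d. Let W \subseteq S_d be a k-linear subspace of codimension c = dim S_d - dim W, and let W_1 \subseteq S_{d+1} be the image of the multiplication map W \otimes S_1 \to S_{d+1}, i.e. the k-span of all products x_i w with w \in W and 0 \le i \le n. Then the codimension c_1 of W_1 in S_{d+1} satisfies c_1 \le c^{<d>}. -/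
open MvPolynomial

/-- The Macaulay growth function `a ↦ a^{<d>}`, computed greedily: if `m` is the largest number with
`C(m, d) ≤ a`, then `a^{<d>} = C(m + 1, d + 1) + (a - C(m, d))^{<d - 1>}`. -/
def macaulayGrowth : ℕ → ℕ → ℕ
  | 0, _ => 0
  | d + 1, a =>
    let m := Nat.findGreatest (fun m => m.choose (d + 1) ≤ a) (a + d)
    (m + 1).choose (d + 2) + macaulayGrowth d (a - m.choose (d + 1))

theorem Nat.lt_choose_add_succ (a d : ℕ) : a < (a + d + 1).choose (d + 1) := by
  induction a with
  | zero => simp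
  | succ a ih =>
    have h1 : (a + 1 + d + 1).choose (d + 1) =
        (a + d + 1).choose d + (a + d + 1).choose (d + 1) := by
      rw [show a + 1 + d + 1 = a + d + 1 + 1 by ring, Nat.choose_succ_succ']
    have h2 : 0 < (a + d + 1).choose d := Nat.choose_pos (by omega)
    omega

theorem Nat.lt_of_choose_lt_choose {d m n : ℕ} (h : m.choose d < n.choose d) : m < n := by
  by_contra! hle
  exact absurd (Nat.choose_le_choose d hle) (by omega)

theorem Nat.exists_choose_add_lt (d a : ℕ) :
    ∃ m q : ℕ, a = m.choose (d + 1) + q ∧ q < m.choose d := by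
  have hex : ∃ m, a < (m + 1).choose (d + 1) := ⟨a + d, Nat.lt_choose_add_succ a d⟩
  have hfind := Nat.find_spec hex
  have hle : (Nat.find hex).choose (d + 1) ≤ a := by
    rcases h : Nat.find hex with _ | m
    · simp
    · have := Nat.find_min hex (m := m) (by omega)
      omega
  rw [Nat.choose_succ_succ'] at hfind
  exact ⟨Nat.find hex, a - (Nat.find hex).choose (d + 1), by omega, by omega⟩

theorem Nat.exists_choose_add_le (d : ℕ) {a : ℕ} (ha : 0 < a) :
    ∃ m q : ℕ, a = m.choose (d + 1) + q ∧ 0 < q ∧ q ≤ m.choose d := by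
  obtain ⟨m, q, h1, h2⟩ := Nat.exists_choose_add_lt d (a - 1)
  exact ⟨m, q + 1, by omega, by omega, by omega⟩

theorem macaulayGrowth_choose_add_of_lt {d m q : ℕ} (hq : q < m.choose d) :
    macaulayGrowth (d + 1) (m.choose (d + 1) + q) =
      (m + 1).choose (d + 2) + macaulayGrowth d q := by
  have hgt : m.choose (d + 1) + q < (m + 1).choose (d + 1) := by
    rw [Nat.choose_succ_succ']; omega
  have hm : Nat.findGreatest (fun k => k.choose (d + 1) ≤ m.choose (d + 1) + q)
      (m.choose (d + 1) + q + d) = m := by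
    rw [Nat.findGreatest_eq_iff]
    refine ⟨?_, fun _ => by omega, fun k hk _ => ?_⟩
    · by_contra! hlt
      have := Nat.choose_le_choose (d + 1) (show m.choose (d + 1) + q + d + 1 ≤ m from hlt)
      have := Nat.lt_choose_add_succ (m.choose (d + 1) + q) d
      omega
    · have := Nat.choose_le_choose (d + 1) (show m + 1 ≤ k from hk)
      omega
  simp [macaulayGrowth, hm]

@[simp]
theorem macaulayGrowth_zero_right (d : ℕ) : macaulayGrowth d 0 = 0 := by
  induction d with
  | zero => rfl
  | succ d ih => simpa [ih] using macaulayGrowth_choose_add_of_lt (d := d) (m := d) (q := 0) (by simp)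

theorem macaulayGrowth_choose (d m : ℕ) :
    macaulayGrowth (d + 1) (m.choose (d + 1)) = (m + 1).choose (d + 2) := by
  rcases Nat.lt_or_ge m d with h | h
  · simp [Nat.choose_eq_zero_of_lt (show m < d + 1 by omega),
      Nat.choose_eq_zero_of_lt (show m + 1 < d + 2 by omega)]
  · simpa using macaulayGrowth_choose_add_of_lt (Nat.choose_pos h)

theorem macaulayGrowth_choose_add {d m q : ℕ} (hq : q ≤ m.choose (d + 1)) :
    macaulayGrowth (d + 2) (m.choose (d + 2) + q) =
      (m + 1).choose (d + 3) + macaulayGrowth (d + 1) q := by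
  rcases hq.lt_or_eq with h | rfl
  · exact macaulayGrowth_choose_add_of_lt h
  · rw [add_comm (m.choose _), ← Nat.choose_succ_succ', macaulayGrowth_choose,
      macaulayGrowth_choose, Nat.choose_succ_succ' (m + 1) (d + 2), add_comm]

theorem macaulayGrowth_one (a : ℕ) : macaulayGrowth 1 a = (a + 1).choose 2 := by
  simpa using macaulayGrowth_choose 0 a

theorem le_macaulayGrowth (d a : ℕ) : a ≤ macaulayGrowth (d + 1) a := by
  induction d generalizing a with
  | zero =>
    rw [macaulayGrowth_one, Nat.choose_succ_succ']
    simp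
  | succ d ih =>
    obtain ⟨m, q, rfl, hq⟩ := Nat.exists_choose_add_lt (d + 1) a
    have := ih q
    rw [macaulayGrowth_choose_add hq.le, Nat.choose_succ_succ' m (d + 2)]
    simp only [Nat.add_assoc, Nat.reduceAdd] at *
    omega

theorem macaulayGrowth_one_add (x y : ℕ) :
    macaulayGrowth 1 (x + y) = macaulayGrowth 1 x + macaulayGrowth 1 y + x * y := by
  have h (a : ℕ) : 2 * (a + 1).choose 2 = a * (a + 1) := by
    have := Nat.triangle_succ a
    rw [Nat.choose_two_right, Nat.mul_div_cancel'
      (by simpa [mul_comm] using Nat.even_mul_succ_self a |>.two_dvd)]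
    simp [mul_comm]
  simp only [macaulayGrowth_one]
  nlinarith [h x, h y, h (x + y)]

/-- Moving mass from the smaller to the larger of two arguments, under a cap `C(l, d + 1)`, does
not decrease the sum of the values of the growth function. -/
theorem macaulayGrowth_add_le_of_le {d l : ℕ} {x y : ℕ} (hyx : y ≤ x)
    (hx : x ≤ l.choose (d + 1)) :
    (x + y ≤ l.choose (d + 1) →
      macaulayGrowth (d + 1) x + macaulayGrowth (d + 1) y ≤ macaulayGrowth (d + 1) (x + y)) ∧
    (l.choose (d + 1) ≤ x + y →
      macaulayGrowth (d + 1) x + macaulayGrowth (d + 1) y ≤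
        macaulayGrowth (d + 1) (l.choose (d + 1)) +
          macaulayGrowth (d + 1) (x + y - l.choose (d + 1))) := by
  induction d generalizing l x y with
  | zero =>
    simp only [zero_add, Nat.choose_one_right] at *
    refine ⟨fun _ => ?_, fun h => ?_⟩
    · rw [macaulayGrowth_one_add]; omega
    · obtain ⟨t, rfl⟩ := Nat.exists_eq_add_of_le hx
      obtain ⟨s, rfl⟩ := Nat.exists_eq_add_of_le (show t ≤ y by omega)
      rw [show x + (t + s) - (x + t) = s by omega, macaulayGrowth_one_add x t,
        macaulayGrowth_one_add t s]
      nlinarith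
  | succ d ih =>
    change x ≤ l.choose (d + 2) at hx
    change (x + y ≤ l.choose (d + 2) → macaulayGrowth (d + 2) x + macaulayGrowth (d + 2) y ≤
        macaulayGrowth (d + 2) (x + y)) ∧
      (l.choose (d + 2) ≤ x + y → macaulayGrowth (d + 2) x + macaulayGrowth (d + 2) y ≤
        macaulayGrowth (d + 2) (l.choose (d + 2)) +
          macaulayGrowth (d + 2) (x + y - l.choose (d + 2)))
    induction y using Nat.strong_induction_on generalizing x with
    | _ y ihy =>
    rcases Nat.eq_zero_or_pos y with rfl | hy
    · refine ⟨fun _ => by simp, fun h => ?_⟩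
      obtain rfl : x = l.choose (d + 2) := by omega
      simp
    rcases hx.eq_or_lt with rfl | hxl
    · exact ⟨fun h => by omega, fun h => by simp⟩
    obtain ⟨i, y', rfl, hy0, hy'⟩ : ∃ i y' : ℕ, y = i.choose (d + 2) + y' ∧ 0 < y' ∧
        y' ≤ i.choose (d + 1) := Nat.exists_choose_add_le (d + 1) hy
    obtain ⟨j, x', rfl, hx'⟩ : ∃ j x' : ℕ, x = j.choose (d + 2) + x' ∧ x' < j.choose (d + 1) :=
      Nat.exists_choose_add_lt (d + 1) x
    have hj : (j + 1).choose (d + 2) = j.choose (d + 1) + j.choose (d + 2) :=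
      Nat.choose_succ_succ' j (d + 1)
    have hij : i < j + 1 := Nat.lt_of_choose_lt_choose (d := d + 2) (by omega)
    have hjl : j < l := Nat.lt_of_choose_lt_choose (d := d + 2) (by omega)
    have hl := Nat.choose_le_choose (d + 2) (show j + 1 ≤ l from hjl)
    have hR := Nat.choose_le_choose (d + 1) (show i ≤ j by omega)
    have hmove : (x' + y' ≤ j.choose (d + 1) →
          macaulayGrowth (d + 1) x' + macaulayGrowth (d + 1) y' ≤
            macaulayGrowth (d + 1) (x' + y')) ∧
        (j.choose (d + 1) ≤ x' + y' →
          macaulayGrowth (d + 1) x' + macaulayGrowth (d + 1) y' ≤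
            macaulayGrowth (d + 1) (j.choose (d + 1)) +
              macaulayGrowth (d + 1) (x' + y' - j.choose (d + 1))) := by
      rcases le_total y' x' with h | h
      · exact ih h hx'.le
      · simpa only [add_comm] using ih h (hy'.trans hR)
    obtain ⟨t, ht0, hty, htx, hle⟩ : ∃ t, 0 < t ∧ t ≤ y' ∧ x' + t ≤ j.choose (d + 1) ∧
        macaulayGrowth (d + 1) x' + macaulayGrowth (d + 1) y' ≤
          macaulayGrowth (d + 1) (x' + t) + macaulayGrowth (d + 1) (y' - t) := by
      rcases le_total (x' + y') (j.choose (d + 1)) with h | h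
      · exact ⟨y', hy0, le_rfl, h, by simpa using hmove.1 h⟩
      · refine ⟨j.choose (d + 1) - x', by omega, by omega, by omega, ?_⟩
        convert hmove.2 h using 3 <;> omega
    have hnew := ihy (i.choose (d + 2) + (y' - t)) (by omega)
      (x := j.choose (d + 2) + (x' + t)) (by omega) (by omega)
    rw [macaulayGrowth_choose_add htx, macaulayGrowth_choose_add (show y' - t ≤ _ by omega),
      show j.choose (d + 2) + (x' + t) + (i.choose (d + 2) + (y' - t)) =
        j.choose (d + 2) + x' + (i.choose (d + 2) + y') by omega] at hnew
    rw [macaulayGrowth_choose_add hx'.le, macaulayGrowth_choose_add hy']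
    exact ⟨fun h => by have := hnew.1 h; omega, fun h => by have := hnew.2 h; omega⟩

theorem macaulayGrowth_add_le_of_choose_le {d l x y : ℕ} (hx : x ≤ l.choose (d + 1))
    (hy : y ≤ l.choose (d + 1)) (h : l.choose (d + 1) ≤ x + y) :
    macaulayGrowth (d + 1) x + macaulayGrowth (d + 1) y ≤
      macaulayGrowth (d + 1) (l.choose (d + 1)) +
        macaulayGrowth (d + 1) (x + y - l.choose (d + 1)) := by
  rcases le_total y x with hyx | hyx
  · exact (macaulayGrowth_add_le_of_le hyx hx).2 h
  · simpa only [add_comm] using (macaulayGrowth_add_le_of_le hyx hy).2 (by omega)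

theorem macaulayGrowth_add_le (d x y : ℕ) :
    macaulayGrowth (d + 1) x + macaulayGrowth (d + 1) y ≤ macaulayGrowth (d + 1) (x + y) := by
  have hl := Nat.lt_choose_add_succ (x + y) d
  rcases le_total y x with hyx | hyx
  · exact (macaulayGrowth_add_le_of_le hyx (by omega)).1 hl.le
  · simpa only [add_comm] using
      (macaulayGrowth_add_le_of_le (l := x + y + d + 1) (d := d) hyx (by omega)).1 (by omega)

theorem macaulayGrowth_mono (d : ℕ) : Monotone (macaulayGrowth (d + 1)) := by
  intro x y h
  obtain ⟨t, rfl⟩ := Nat.exists_eq_add_of_le h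
  have := macaulayGrowth_add_le d x t
  omega

/-- Splitting `x + y` either makes `macaulayGrowth (d + 1)` grow by at least `x + y` from `x`, or
`macaulayGrowth (d + 1)` dominates the sum of the growths of `x` in degree `d + 1` and `y` in
degree `d`. -/
theorem macaulayGrowth_add_cases {d m x y : ℕ} (h : x + y ≤ (m + 1).choose (d + 1)) :
    macaulayGrowth (d + 1) x + (x + y) ≤ macaulayGrowth (d + 1) (x + y) ∨ y = 0 ∨
      (1 ≤ d ∧ y ≤ m.choose d ∧
        macaulayGrowth (d + 1) x + macaulayGrowth d y ≤ macaulayGrowth (d + 1) (x + y)) := by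
  induction d generalizing m x y with
  | zero =>
    rcases Nat.eq_zero_or_pos y with rfl | hy
    · simp
    · left
      rw [zero_add, macaulayGrowth_one_add]
      have := le_macaulayGrowth 0 y
      rw [zero_add] at this
      nlinarith
  | succ d ih =>
    change x + y ≤ (m + 1).choose (d + 2) at h
    change macaulayGrowth (d + 2) x + (x + y) ≤ macaulayGrowth (d + 2) (x + y) ∨ y = 0 ∨
      (1 ≤ d + 1 ∧ y ≤ m.choose (d + 1) ∧
        macaulayGrowth (d + 2) x + macaulayGrowth (d + 1) y ≤ macaulayGrowth (d + 2) (x + y))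
    rcases Nat.eq_zero_or_pos (x + y) with h0 | hpos
    · right; left; omega
    obtain ⟨l, q, hl, hq0, hq⟩ : ∃ l q : ℕ, x + y = l.choose (d + 2) + q ∧ 0 < q ∧
        q ≤ l.choose (d + 1) := Nat.exists_choose_add_le (d + 1) hpos
    have hlm : l < m + 1 := Nat.lt_of_choose_lt_choose (d := d + 2) (by omega)
    obtain ⟨p, rfl⟩ : ∃ p, l = p + 1 := by
      rcases l with _ | p
      · simp at hq; omega
      · exact ⟨p, rfl⟩
    have hm1 := Nat.choose_le_choose (d + 1) (show p + 1 ≤ m by omega)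
    have hp2 : (p + 1).choose (d + 2) = p.choose (d + 1) + p.choose (d + 2) :=
      Nat.choose_succ_succ' p (d + 1)
    have hp1 := Nat.choose_succ_succ' p d
    have hp3 : (p + 2).choose (d + 3) = (p + 1).choose (d + 2) + (p + 1).choose (d + 3) :=
      Nat.choose_succ_succ' (p + 1) (d + 2)
    have hpm := Nat.choose_le_choose (d + 1) (show p ≤ p + 1 by omega)
    have hfa : macaulayGrowth (d + 2) ((p + 1).choose (d + 2) + q) =
        (p + 2).choose (d + 3) + macaulayGrowth (d + 1) q := macaulayGrowth_choose_add hq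
    rw [← hl] at hfa
    have hqle := le_macaulayGrowth d q
    rcases le_total x (p.choose (d + 2)) with hx | hx
    · left
      have hfx : macaulayGrowth (d + 2) x ≤ (p + 1).choose (d + 3) :=
        (macaulayGrowth_mono (d + 1) hx).trans_eq (macaulayGrowth_choose (d + 1) p)
      omega
    rcases le_total x ((p + 1).choose (d + 2)) with hx2 | hx2
    · obtain ⟨x', rfl⟩ := Nat.exists_eq_add_of_le hx
      have hx' : x' ≤ p.choose (d + 1) := by omega
      rw [macaulayGrowth_choose_add hx']
      rcases le_total x' q with hxq | hxq
      · obtain ⟨s, rfl⟩ := Nat.exists_eq_add_of_le hxq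
        obtain rfl : y = p.choose (d + 1) + s := by omega
        rcases ih hq with h1 | rfl | ⟨hd, hs, h1⟩
        · left; omega
        · right; right
          simp only [add_zero] at *
          rw [macaulayGrowth_choose]
          refine ⟨by omega, by omega, ?_⟩
          omega
        · right; right
          obtain ⟨d, rfl⟩ := Nat.exists_eq_add_of_le' hd
          rw [macaulayGrowth_choose_add hs]
          simp only [Nat.add_assoc, Nat.reduceAdd] at *
          refine ⟨by omega, by omega, ?_⟩
          omega
      · right; right
        have := macaulayGrowth_add_le_of_choose_le (y := y) hx' (by omega) (by omega)
        rw [macaulayGrowth_choose, show x' + y - p.choose (d + 1) = q by omega] at this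
        refine ⟨by omega, by omega, ?_⟩
        omega
    · right; right
      obtain ⟨x', rfl⟩ := Nat.exists_eq_add_of_le hx2
      obtain rfl : q = x' + y := by omega
      have := macaulayGrowth_add_le d x' y
      rw [macaulayGrowth_choose_add (show x' ≤ (p + 1).choose (d + 1) by omega)]
      simp only [Nat.add_assoc, Nat.reduceAdd] at *
      refine ⟨by omega, by omega, ?_⟩
      omega

theorem StrictMono.sum_choose_lt {d K : ℕ} {f : Fin d → ℕ} (hf : StrictMono f)
    (hK : ∀ i, f i < K) : ∑ i, (f i).choose (i.1 + 1) < K.choose d := by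
  induction d generalizing K with
  | zero => simp
  | succ d ih =>
    rw [Fin.sum_univ_castSucc]
    have := ih (hf.comp Fin.strictMono_castSucc) (fun i => hf (Fin.castSucc_lt_last i))
    have h2 := Nat.choose_le_choose (d + 1) (show f (Fin.last d) + 1 ≤ K from hK _)
    rw [Nat.choose_succ_succ'] at h2
    simp only [Fin.val_castSucc, Fin.val_last, Function.comp_apply] at this ⊢
    omega

theorem macaulayGrowth_sum_choose {d : ℕ} {f : Fin d → ℕ} (hf : StrictMono f) :
    macaulayGrowth d (∑ i, (f i).choose (i.1 + 1)) = ∑ i, (f i + 1).choose (i.1 + 2) := by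
  induction d with
  | zero => simp [macaulayGrowth]
  | succ d ih =>
    have hmono := hf.comp Fin.strictMono_castSucc
    have hlt := hmono.sum_choose_lt (fun i => hf (Fin.castSucc_lt_last i))
    have hsum := ih hmono
    simp only [Fin.sum_univ_castSucc, Fin.val_castSucc, Fin.val_last, Function.comp_apply]
      at hlt hsum ⊢
    rw [add_comm (∑ i, _), macaulayGrowth_choose_add_of_lt hlt, hsum, add_comm]

namespace MvPolynomial

section Growth

variable {k : Type*} [Field k]

instance finite_homogeneousSubmodule {σ : Type*} [Finite σ] (d : ℕ) :
    Module.Finite k (homogeneousSubmodule σ k d) :=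
  Module.Finite.iff_fg.mpr (homogeneousSubmodule_fg σ k d)

/-- The span of the products `X i * w` with `w ∈ W`, that is, the image of `W ⊗ S₁`. -/
noncomputable def mulVars {σ : Type*} (W : Submodule k (MvPolynomial σ k)) :
    Submodule k (MvPolynomial σ k) :=
  Submodule.span k {p | ∃ w ∈ W, ∃ i, p = X i * w}

theorem X_mul_mem_mulVars {σ : Type*} {W : Submodule k (MvPolynomial σ k)}
    {w : MvPolynomial σ k} (hw : w ∈ W) (i : σ) : X i * w ∈ mulVars W :=
  Submodule.subset_span ⟨w, hw, i, rfl⟩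

theorem mulVars_le_homogeneousSubmodule {σ : Type*} {W : Submodule k (MvPolynomial σ k)} {d : ℕ}
    (hW : W ≤ homogeneousSubmodule σ k d) : mulVars W ≤ homogeneousSubmodule σ k (d + 1) := by
  rw [mulVars, Submodule.span_le]
  rintro _ ⟨w, hw, i, rfl⟩
  rw [add_comm d]
  exact (isHomogeneous_X k i).mul (hW hw)

theorem homogeneousSubmodule_succ_le_mulVars {σ : Type*} (d : ℕ) :
    homogeneousSubmodule σ k (d + 1) ≤ mulVars (homogeneousSubmodule σ k d) := by
  rw [← homogeneousSubmodule_one_pow _ (d + 1), pow_succ', homogeneousSubmodule_one_pow,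
    homogeneousSubmodule_one_eq_span_X, Submodule.mul_le]
  intro p hp q hq
  induction hp using Submodule.span_induction with
  | mem p hp =>
    obtain ⟨i, rfl⟩ := hp
    exact X_mul_mem_mulVars hq i
  | zero => simp
  | add p p' _ _ h h' => rw [add_mul]; exact add_mem h h'
  | smul c p _ h => rw [smul_mul_assoc]; exact Submodule.smul_mem _ c h

variable {n : ℕ}

variable (k n) in
/-- Setting the first variable to zero. -/
noncomputable def killZero : MvPolynomial (Fin (n + 1)) k →ₐ[k] MvPolynomial (Fin n) k :=
  aeval (Fin.cases 0 X)

theorem killZero_apply (p : MvPolynomial (Fin (n + 1)) k) :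
    killZero k n p = (finSuccEquiv k n p).coeff 0 := by
  have : killZero k n = ((Polynomial.aeval (0 : MvPolynomial (Fin n) k)).restrictScalars k).comp
      (finSuccEquiv k n).toAlgHom := by
    ext i : 1
    refine Fin.cases ?_ (fun j => ?_) i
    · simp [killZero, finSuccEquiv_X_zero]
    · simp [killZero, finSuccEquiv_X_succ]
  rw [this, Polynomial.coeff_zero_eq_aeval_zero]
  rfl

theorem killZero_X_zero_mul (p : MvPolynomial (Fin (n + 1)) k) : killZero k n (X 0 * p) = 0 := by
  simp [killZero]

theorem killZero_X_succ_mul (i : Fin n) (p : MvPolynomial (Fin (n + 1)) k) :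
    killZero k n (X i.succ * p) = X i * killZero k n p := by
  simp [killZero]

theorem exists_eq_X_zero_mul {p : MvPolynomial (Fin (n + 1)) k} (hp : killZero k n p = 0) :
    ∃ q, p = X 0 * q := by
  rw [killZero_apply, ← Polynomial.X_dvd_iff] at hp
  obtain ⟨q, hq⟩ := hp
  refine ⟨(finSuccEquiv k n).symm q, (finSuccEquiv k n).injective ?_⟩
  rw [map_mul, finSuccEquiv_X_zero, AlgEquiv.apply_symm_apply, hq]

theorem map_killZero_homogeneousSubmodule (d : ℕ) :
    (homogeneousSubmodule (Fin (n + 1)) k d).map (killZero k n).toLinearMap =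
      homogeneousSubmodule (Fin n) k d := by
  apply le_antisymm
  · rintro _ ⟨p, hp, rfl⟩
    rw [AlgHom.toLinearMap_apply, killZero_apply]
    exact IsHomogeneous.finSuccEquiv_coeff_isHomogeneous hp 0 d (zero_add d)
  · intro p hp
    refine ⟨rename Fin.succ p, IsHomogeneous.rename_isHomogeneous hp, ?_⟩
    have : (killZero k n).comp (rename Fin.succ) = AlgHom.id k _ := by
      ext i : 1
      simp [killZero]
    exact DFunLike.congr_fun this p

/-- The polynomials `p` with `X 0 * p ∈ W`. -/
noncomputable def colonX (W : Submodule k (MvPolynomial (Fin (n + 1)) k)) :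
    Submodule k (MvPolynomial (Fin (n + 1)) k) :=
  W.comap (LinearMap.mulLeft k (X 0))

@[simp]
theorem mem_colonX {W : Submodule k (MvPolynomial (Fin (n + 1)) k)}
    {p : MvPolynomial (Fin (n + 1)) k} : p ∈ colonX W ↔ X 0 * p ∈ W :=
  Iff.rfl

theorem colonX_mono {W W' : Submodule k (MvPolynomial (Fin (n + 1)) k)} (h : W ≤ W') :
    colonX W ≤ colonX W' :=
  Submodule.comap_mono h

theorem colonX_homogeneousSubmodule (d : ℕ) :
    colonX (homogeneousSubmodule (Fin (n + 1)) k (d + 1)) =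
      homogeneousSubmodule (Fin (n + 1)) k d := by
  ext p
  rw [mem_colonX, mem_homogeneousSubmodule, mem_homogeneousSubmodule]
  refine ⟨fun h m hm => ?_, fun h => by
    rw [add_comm d]; exact (isHomogeneous_X k 0).mul h⟩
  have := h (d := Finsupp.single 0 1 + m) (by rwa [coeff_X_mul])
  rw [map_add, Finsupp.weight_single] at this
  simp at this
  omega

theorem finrank_eq_map_killZero_add_colonX {d : ℕ}
    {W : Submodule k (MvPolynomial (Fin (n + 1)) k)}
    (hW : W ≤ homogeneousSubmodule (Fin (n + 1)) k d) :
    Module.finrank k W =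
      Module.finrank k (W.map (killZero k n).toLinearMap) + Module.finrank k (colonX W) := by
  have : Module.Finite k W := Submodule.finiteDimensional_of_le hW
  have hinj : Function.Injective (LinearMap.mulLeft k (X 0 : MvPolynomial (Fin (n + 1)) k)) :=
    fun p q h => mul_left_cancel₀ (X_ne_zero 0) h
  have hker : (LinearMap.ker ((killZero k n).toLinearMap.domRestrict W)).map W.subtype =
      (colonX W).map (LinearMap.mulLeft k (X 0)) := by
    ext p
    simp only [Submodule.mem_map, LinearMap.mem_ker, LinearMap.domRestrict_apply,
      AlgHom.toLinearMap_apply, Submodule.subtype_apply, mem_colonX, LinearMap.mulLeft_apply]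
    constructor
    · rintro ⟨p, hp, rfl⟩
      obtain ⟨q, hq⟩ := exists_eq_X_zero_mul hp
      exact ⟨q, hq ▸ p.2, hq.symm⟩
    · rintro ⟨q, hq, rfl⟩
      exact ⟨⟨X 0 * q, hq⟩, killZero_X_zero_mul q, rfl⟩
  rw [← LinearMap.finrank_range_add_finrank_ker ((killZero k n).toLinearMap.domRestrict W),
    LinearMap.range_domRestrict, ← Submodule.finrank_map_subtype_eq, hker,
    (Submodule.equivMapOfInjective _ hinj (colonX W)).finrank_eq]

theorem mulVars_map_killZero_le (W : Submodule k (MvPolynomial (Fin (n + 1)) k)) :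
    mulVars (W.map (killZero k n).toLinearMap) ≤ (mulVars W).map (killZero k n).toLinearMap := by
  rw [mulVars, Submodule.span_le]
  rintro _ ⟨_, ⟨w, hw, rfl⟩, i, rfl⟩
  exact ⟨X i.succ * w, X_mul_mem_mulVars hw _, killZero_X_succ_mul i w⟩

theorem mulVars_colonX_le (W : Submodule k (MvPolynomial (Fin (n + 1)) k)) :
    mulVars (colonX W) ≤ colonX (mulVars W) := by
  rw [mulVars, Submodule.span_le]
  rintro _ ⟨w, hw, i, rfl⟩
  rw [SetLike.mem_coe, mem_colonX, mul_left_comm]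
  rw [mem_colonX] at hw
  exact X_mul_mem_mulVars hw i

theorem le_colonX_mulVars (W : Submodule k (MvPolynomial (Fin (n + 1)) k)) :
    W ≤ colonX (mulVars W) :=
  fun _ hw => X_mul_mem_mulVars hw 0

theorem finrank_homogeneousSubmodule_succ_le (n d : ℕ) (W : Submodule k (MvPolynomial (Fin n) k))
    (hW : W ≤ homogeneousSubmodule (Fin n) k (d + 1)) :
    Module.finrank k (homogeneousSubmodule (Fin n) k (d + 2)) ≤
      Module.finrank k (mulVars W) + macaulayGrowth (d + 1)
        (Module.finrank k (homogeneousSubmodule (Fin n) k (d + 1)) - Module.finrank k W) := by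
  induction n generalizing d with
  | zero =>
    have h : homogeneousSubmodule (Fin 0) k (d + 2) = ⊥ := by
      rw [eq_bot_iff]
      intro p hp
      by_contra hne
      exact absurd (IsHomogeneous.inj_right hp (isHomogeneous_of_isEmpty _ _ p) hne) (by omega)
    rw [h, finrank_bot]
    exact Nat.zero_le _
  | succ n ihn =>
    induction d using Nat.strong_induction_on generalizing W with
    | _ d ihd =>
    have hU := mulVars_le_homogeneousSubmodule hW
    have hπW : W.map (killZero k n).toLinearMap ≤ homogeneousSubmodule (Fin n) k (d + 1) :=
      (Submodule.map_mono hW).trans_eq (map_killZero_homogeneousSubmodule _)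
    have hCW : colonX W ≤ homogeneousSubmodule (Fin (n + 1)) k d :=
      (colonX_mono hW).trans_eq (colonX_homogeneousSubmodule _)
    have hCU : colonX (mulVars W) ≤ homogeneousSubmodule (Fin (n + 1)) k (d + 1) :=
      (colonX_mono hU).trans_eq (colonX_homogeneousSubmodule _)
    have hπU : (mulVars W).map (killZero k n).toLinearMap ≤
        homogeneousSubmodule (Fin n) k (d + 2) :=
      (Submodule.map_mono hU).trans_eq (map_killZero_homogeneousSubmodule _)
    have : Module.Finite k (colonX (mulVars W)) := Submodule.finiteDimensional_of_le hCU
    have : Module.Finite k ((mulVars W).map (killZero k n).toLinearMap) :=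
      Submodule.finiteDimensional_of_le hπU
    have rankS (e : ℕ) :
        Module.finrank k (homogeneousSubmodule (Fin (n + 1)) k (e + 1)) =
          Module.finrank k (homogeneousSubmodule (Fin n) k (e + 1)) +
            Module.finrank k (homogeneousSubmodule (Fin (n + 1)) k e) := by
      have h := finrank_eq_map_killZero_add_colonX
        (le_refl (homogeneousSubmodule (Fin (n + 1)) k (e + 1)))
      rwa [map_killZero_homogeneousSubmodule, colonX_homogeneousSubmodule] at h
    have rankS₁ := rankS d
    have rankS₂ : Module.finrank k (homogeneousSubmodule (Fin (n + 1)) k (d + 2)) =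
        Module.finrank k (homogeneousSubmodule (Fin n) k (d + 2)) +
          Module.finrank k (homogeneousSubmodule (Fin (n + 1)) k (d + 1)) := rankS (d + 1)
    have rankU := finrank_eq_map_killZero_add_colonX hU
    have rankW := finrank_eq_map_killZero_add_colonX hW
    have leπW := Submodule.finrank_mono hπW
    have leCW := Submodule.finrank_mono hCW
    have leπ := Submodule.finrank_mono (mulVars_map_killZero_le W)
    have leC := Submodule.finrank_mono (mulVars_colonX_le W)
    have leW := Submodule.finrank_mono (le_colonX_mulVars W)
    have ihπ := ihn d _ hπW
    obtain ⟨x, hx⟩ := Nat.exists_eq_add_of_le leπW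
    obtain ⟨y, hy⟩ := Nat.exists_eq_add_of_le leCW
    rw [hx, Nat.add_sub_cancel_left] at ihπ
    rw [show Module.finrank k (homogeneousSubmodule (Fin (n + 1)) k (d + 1)) -
      Module.finrank k W = x + y by omega]
    rcases macaulayGrowth_add_cases (Nat.lt_choose_add_succ (x + y) d).le with
      h | rfl | ⟨hd, -, h⟩
    · omega
    · have hC : colonX W = homogeneousSubmodule (Fin (n + 1)) k d :=
        Submodule.eq_of_le_of_finrank_eq hCW (by omega)
      rw [hC] at leC
      rw [add_zero]
      have : Module.Finite k (mulVars (homogeneousSubmodule (Fin (n + 1)) k d)) :=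
        Submodule.finiteDimensional_of_le (mulVars_le_homogeneousSubmodule le_rfl)
      have := Submodule.finrank_mono
        (homogeneousSubmodule_succ_le_mulVars (k := k) (σ := Fin (n + 1)) d)
      omega
    · obtain ⟨e, rfl⟩ := Nat.exists_eq_add_of_le' hd
      have ihC : Module.finrank k (homogeneousSubmodule (Fin (n + 1)) k (e + 1 + 1)) ≤
          Module.finrank k (mulVars (colonX W)) + macaulayGrowth (e + 1)
            (Module.finrank k (homogeneousSubmodule (Fin (n + 1)) k (e + 1)) -
              Module.finrank k (colonX W)) := ihd e (by omega) _ hCW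
      rw [hy, Nat.add_sub_cancel_left] at ihC
      omega

end Growth

end MvPolynomial

/-- **Macaulay's growth theorem.** Let `k` be a field, `S = k[x_0, …, x_n]`, `S_d` the space of
homogeneous polynomials of degree `d`.  Let `W ⊆ S_d` be a subspace of codimension
`c = dim S_d - dim W`, and `W₁ ⊆ S_{d+1}` the image of the multiplication map
`W ⊗ S_1 → S_{d+1}`, i.e. the span of the products `x_i * w` with `w ∈ W`.  Then the
codimension `c₁` of `W₁` in `S_{d+1}` satisfies `c₁ ≤ c^{<d>}`, where `c^{<d>}` is computed
from the `d`-th Macaulay representation `c = C(k_d, d) + ⋯ + C(k_1, 1)` (`k_d > ⋯ > k_1 ≥ 0`,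
encoded by the strictly monotone `kseq : Fin d → ℕ`) as
`c^{<d>} = C(k_d+1, d+1) + ⋯ + C(k_1+1, 2)`  (by convention `0^{<d>} = 0`, corresponding to
the unique Macaulay representation of `0`). -/
theorem macaulay_growth_theorem (k : Type*) [Field k] (n d : ℕ) (hd : 1 ≤ d)
    (W : Submodule k (MvPolynomial (Fin (n + 1)) k))
    (hW : W ≤ homogeneousSubmodule (Fin (n + 1)) k d)
    (kseq : Fin d → ℕ) (hmono : StrictMono kseq)
    (hrep : Module.finrank k (homogeneousSubmodule (Fin (n + 1)) k d) - Module.finrank k W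
      = ∑ i : Fin d, Nat.choose (kseq i) (i.1 + 1)) :
    Module.finrank k (homogeneousSubmodule (Fin (n + 1)) k (d + 1)) -
      Module.finrank k (Submodule.span k
        {p : MvPolynomial (Fin (n + 1)) k | ∃ w ∈ W, ∃ i : Fin (n + 1), p = X i * w})
      ≤ ∑ i : Fin d, Nat.choose (kseq i + 1) (i.1 + 2) := by
  obtain ⟨d, rfl⟩ := Nat.exists_eq_add_of_le' hd
  have h := finrank_homogeneousSubmodule_succ_le (n + 1) d W hW
  rw [hrep, macaulayGrowth_sum_choose hmono, mulVars] at h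
  rw [Nat.sub_le_iff_le_add']
  exact h
end

section
/- (Green's hyperplane restriction theorem) Let k be an algebraically closed field, S = k[x_0, ..., x_n] the polynomial ring with S_d its space of homogeneous polynomials of degree d. Let W \subseteq S_d be a k-linear subspace of codimension c = dim S_d - dim W. Then there is a nonempty Zariski-open subset U of the space S_1 of linear forms such that for every l \in U, the image W_l of W under the quotient map S_d \to (S/(l))_d has codimension c_l in (S/(l))_d satisfying c_l \le c_{<d>}. -/
theorem lt_choose_add (d c : ℕ) : c < (c + d + 1).choose (d + 1) := by
  induction c with
  | zero => simp
  | succ c ih =>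
    have h : 0 < (c + d + 1).choose d := Nat.choose_pos (by omega)
    have := Nat.choose_succ_succ (c + d + 1) d
    rw [show c + 1 + d + 1 = (c + d + 1) + 1 by omega]
    simp only [Nat.succ_eq_add_one] at this
    omega

theorem exists_lt_choose (d c : ℕ) : ∃ m, c < (m + 1).choose (d + 1) :=
  ⟨c + d, lt_choose_add d c⟩

/-- The function `c ↦ c_{<d>}`, computed from the greedy Macaulay representation. In degree `0`
it is the identity, the value that makes the recursion uniform. -/
def macaulayLower : ℕ → ℕ → ℕ
  | 0, c => c
  | d + 1, c =>
    (Nat.find (exists_lt_choose d c) - 1).choose (d + 1) +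
      macaulayLower d (c - (Nat.find (exists_lt_choose d c)).choose (d + 1))

theorem macaulayLower_choose_add {d m c : ℕ} (h : c < m.choose d) :
    macaulayLower (d + 1) (m.choose (d + 1) + c) =
      (m - 1).choose (d + 1) + macaulayLower d c := by
  have hf : Nat.find (exists_lt_choose d (m.choose (d + 1) + c)) = m := by
    rw [Nat.find_eq_iff]
    refine ⟨?_, fun j hj => ?_⟩
    · rw [Nat.choose_succ_succ]; simp only [Nat.succ_eq_add_one]; omega
    · have := Nat.choose_le_choose (d + 1) (show j + 1 ≤ m from hj)
      omega
  rw [macaulayLower, hf, Nat.add_sub_cancel_left]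

theorem exists_eq_choose_add (d c : ℕ) :
    ∃ m c' : ℕ, c = m.choose (d + 1) + c' ∧ c' < m.choose d := by
  have h1 := Nat.find_spec (exists_lt_choose d c)
  have h2 := fun j => Nat.find_min (exists_lt_choose d c) (m := j)
  set m := Nat.find (exists_lt_choose d c)
  have h3 : m.choose (d + 1) ≤ c := by
    rcases m with _ | m
    · simp
    · exact not_lt.mp (h2 m (by omega))
  refine ⟨m, c - m.choose (d + 1), by omega, ?_⟩
  rw [Nat.choose_succ_succ] at h1
  simp only [Nat.succ_eq_add_one] at h1
  omega

theorem macaulayLower_choose {d m : ℕ} (h : d ≤ m) :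
    macaulayLower d (m.choose d) = (m - 1).choose d := by
  cases d with
  | zero => simp [macaulayLower]
  | succ d =>
    have h0 : ∀ e, macaulayLower e 0 = 0 := by
      intro e
      induction e with
      | zero => rfl
      | succ e ih =>
        have := macaulayLower_choose_add (d := e) (m := e) (c := 0) (by simp)
        simpa [ih, Nat.choose_eq_zero_of_lt (show e - 1 < e + 1 by omega)] using this
    simpa [h0] using
      macaulayLower_choose_add (d := d) (m := m) (c := 0) (Nat.choose_pos (by omega))

theorem macaulayLower_carry {d m c : ℕ} (hm : 1 ≤ m) (h : c + 1 = m.choose d) :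
    macaulayLower (d + 1) (m.choose (d + 1) + c + 1) =
      (m - 1).choose (d + 1) + macaulayLower d (c + 1) := by
  have hd : d ≤ m := by
    by_contra hlt
    rw [Nat.choose_eq_zero_of_lt (by omega)] at h
    omega
  have e : m.choose (d + 1) + c + 1 = (m + 1).choose (d + 1) := by
    rw [Nat.choose_succ_succ]; simp only [Nat.succ_eq_add_one]; omega
  rw [e, macaulayLower_choose (by omega), h, macaulayLower_choose hd]
  obtain ⟨m, rfl⟩ := Nat.exists_eq_add_of_le' hm
  rw [add_tsub_cancel_right, add_tsub_cancel_right, Nat.choose_succ_succ, add_comm]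

theorem macaulayLower_one (c : ℕ) : macaulayLower 1 c = c - 1 := by
  simpa [macaulayLower] using macaulayLower_choose_add (d := 0) (m := c) (c := 0) (by simp)

theorem macaulayLower_succ_bounds (d c : ℕ) :
    macaulayLower d c ≤ macaulayLower d (c + 1) ∧
      macaulayLower d (c + 1) ≤ macaulayLower d c + 1 := by
  induction d generalizing c with
  | zero => simp [macaulayLower]
  | succ d ih =>
    obtain ⟨m, c', rfl, hc'⟩ := exists_eq_choose_add d c
    have := ih c'
    rw [macaulayLower_choose_add hc']
    rcases Nat.lt_or_ge (c' + 1) (m.choose d) with hlt | hge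
    · rw [add_assoc, macaulayLower_choose_add hlt]
      omega
    · rcases Nat.eq_zero_or_pos m with rfl | hm
      · have hd : d = 0 := by
          by_contra hd
          rw [Nat.choose_eq_zero_of_lt (by omega)] at hc'
          omega
        subst hd
        have : c' = 0 := by simpa using hc'
        subst this
        have h1 : macaulayLower (0 + 1) (Nat.choose 0 (0 + 1) + 0 + 1) = 0 := macaulayLower_one 1
        rw [h1]
        simp [macaulayLower]
      · rw [macaulayLower_carry hm (by omega)]
        omega

theorem macaulayLower_mono (d : ℕ) : Monotone (macaulayLower d) :=
  monotone_nat_of_le_succ fun c => (macaulayLower_succ_bounds d c).1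

theorem macaulayLower_le_add_sub (d : ℕ) {b c : ℕ} (h : b ≤ c) :
    macaulayLower d c ≤ macaulayLower d b + (c - b) := by
  induction c, h using Nat.le_induction with
  | base => simp
  | succ c hc ih =>
    have := (macaulayLower_succ_bounds d c).2
    omega

theorem sum_choose_lt {d m : ℕ} {s : Fin d → ℕ} (hs : StrictMono s) (hm : ∀ i, s i < m) :
    ∑ i, (s i).choose (i.1 + 1) < m.choose d := by
  induction d generalizing m with
  | zero => simp
  | succ d ih =>
    rw [Fin.sum_univ_castSucc]
    have h1 := ih (s := fun i => s i.castSucc) (m := s (Fin.last d))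
      (fun i j hij => hs (by simpa using hij)) (fun i => hs (Fin.castSucc_lt_last i))
    have h2 := Nat.choose_le_choose (d + 1) (show s (Fin.last d) + 1 ≤ m from hm _)
    rw [Nat.choose_succ_succ] at h2
    simp only [Nat.succ_eq_add_one, Fin.val_castSucc, Fin.val_last] at *
    omega

theorem sum_choose_castSucc_lt {d : ℕ} {s : Fin (d + 1) → ℕ} (hs : StrictMono s) :
    ∑ i : Fin d, (s i.castSucc).choose (i.1 + 1) < (s (Fin.last d)).choose d :=
  sum_choose_lt (s := fun i => s i.castSucc) (fun i j hij => hs (by simpa using hij))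
    (fun i => hs (Fin.castSucc_lt_last i))

theorem macaulayLower_sum {d : ℕ} {s : Fin d → ℕ} (hs : StrictMono s) :
    macaulayLower d (∑ i, (s i).choose (i.1 + 1)) = ∑ i, (s i - 1).choose (i.1 + 1) := by
  induction d with
  | zero => simp [macaulayLower]
  | succ d ih =>
    have := ih (s := fun i => s i.castSucc) (fun i j hij => hs (by simpa using hij))
    rw [Fin.sum_univ_castSucc, Fin.sum_univ_castSucc, add_comm (∑ i : Fin d, _)]
    simp only [Fin.val_castSucc, Fin.val_last]
    rw [macaulayLower_choose_add (sum_choose_castSucc_lt hs), this, add_comm]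

theorem macaulayLower_sum_add_one {d : ℕ} {s : Fin (d + 1) → ℕ} (hs : StrictMono s)
    (h0 : s 0 = 0) :
    macaulayLower (d + 1) (∑ i, (s i).choose (i.1 + 1) + 1) =
      macaulayLower (d + 1) (∑ i, (s i).choose (i.1 + 1)) := by
  induction d with
  | zero => simp [macaulayLower_one, h0]
  | succ d ih =>
    have := ih (s := fun i => s i.castSucc) (fun i j hij => hs (by simpa using hij)) h0
    have hlt := sum_choose_castSucc_lt hs
    have hlast : s 0 < s (Fin.last (d + 1)) := hs (Fin.last_pos)
    rw [Fin.sum_univ_castSucc, add_comm (∑ i : Fin (d + 1), _)]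
    simp only [Fin.val_castSucc, Fin.val_last]
    rw [macaulayLower_choose_add hlt]
    rcases Nat.lt_or_ge (∑ i : Fin (d + 1), (s i.castSucc).choose (i.1 + 1) + 1)
      ((s (Fin.last (d + 1))).choose (d + 1)) with h | h
    · rw [add_assoc (Nat.choose _ _), macaulayLower_choose_add h, this]
    · rw [macaulayLower_carry (by omega) (by omega), this]

theorem exists_macaulay_rep_of_lt {d m c : ℕ} (h : c < m.choose d) :
    ∃ s : Fin d → ℕ, StrictMono s ∧ (∀ i, s i < m) ∧ c = ∑ i, (s i).choose (i.1 + 1) := by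
  induction d generalizing m c with
  | zero => exact ⟨Fin.elim0, fun i => i.elim0, fun i => i.elim0, by simpa using h⟩
  | succ d ih =>
    obtain ⟨j, c', rfl, hc'⟩ := exists_eq_choose_add d c
    obtain ⟨s, hs, hsj, rfl⟩ := ih hc'
    have hjm : j < m := by
      by_contra hle
      have := Nat.choose_le_choose (d + 1) (not_lt.mp hle)
      omega
    refine ⟨Fin.snoc s j, ?_, ?_, ?_⟩
    · intro a b hab
      induction b using Fin.lastCases with
      | last =>
        induction a using Fin.lastCases with
        | last => exact absurd hab (lt_irrefl _)
        | cast a => simpa using hsj a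
      | cast b =>
        induction a using Fin.lastCases with
        | last => exact absurd hab (not_lt.mpr (Fin.le_last _))
        | cast a => simpa using hs (by simpa using hab)
    · intro i
      induction i using Fin.lastCases with
      | last => simpa using hjm
      | cast i => simpa using (hsj i).trans hjm
    · rw [Fin.sum_univ_castSucc, add_comm]
      simp

theorem exists_macaulay_rep (d c : ℕ) :
    ∃ s : Fin (d + 1) → ℕ, StrictMono s ∧ c = ∑ i, (s i).choose (i.1 + 1) := by
  obtain ⟨s, hs, -, h⟩ := exists_macaulay_rep_of_lt (lt_choose_add d c)
  exact ⟨s, hs, h⟩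

theorem sum_choose_eq_add {d : ℕ} (s : Fin (d + 1) → ℕ) (h : ∀ i : Fin d, 1 ≤ s i.succ) :
    ∑ i, (s i).choose (i.1 + 1) = ∑ i, (s i - 1).choose (i.1 + 1) +
      ∑ i : Fin d, (s i.succ - 1).choose (i.1 + 1) + (s 0 - (s 0 - 1)) := by
  rw [Fin.sum_univ_succ, Fin.sum_univ_succ (fun i => (s i - 1).choose (i.1 + 1))]
  have : ∀ i : Fin d, (s i.succ).choose (i.succ.1 + 1) =
      (s i.succ - 1).choose (i.succ.1 + 1) + (s i.succ - 1).choose (i.1 + 1) := by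
    intro i
    obtain ⟨m, hm⟩ := Nat.exists_eq_add_of_le' (h i)
    rw [hm, Nat.choose_succ_succ, Fin.val_succ, add_comm]
    rfl
  rw [Finset.sum_congr rfl fun i _ => this i, Finset.sum_add_distrib]
  simp only [Fin.val_zero, zero_add, Nat.choose_one_right]
  omega

theorem le_macaulayLower_of_sub_le {d a b : ℕ} (hba : b ≤ a)
    (h : b - macaulayLower (d + 1 + 1) b ≤ macaulayLower (d + 1) (a - b)) :
    b ≤ macaulayLower (d + 1 + 1) a := by
  obtain ⟨s, hs, rfl⟩ := exists_macaulay_rep (d + 1) a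
  by_contra! hlt
  have hpos : ∀ i : Fin (d + 1), 1 ≤ s i.succ := fun i => by
    have := hs (Fin.succ_pos i)
    omega
  have ha : ∑ i : Fin (d + 1 + 1), (s i).choose (i.1 + 1) = _ := sum_choose_eq_add s hpos
  rw [macaulayLower_sum hs] at hlt
  -- `t` gives the Macaulay representation of `a_{<d>}` when `s` gives that of `a`
  set t : Fin (d + 1 + 1) → ℕ := fun i => max (s i - 1) i.1 with ht
  have htmono : StrictMono t := by
    intro i j hij
    have h1 := hs hij
    have h2 : i.1 < j.1 := hij
    simp only [ht]
    omega
  have hst : ∑ i, (s i - 1).choose (i.1 + 1) = ∑ i, (t i).choose (i.1 + 1) := by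
    refine Finset.sum_congr rfl fun i _ => ?_
    rcases le_total i.1 (s i - 1) with hi | hi
    · simp only [ht, max_eq_left hi]
    · rw [Nat.choose_eq_zero_of_lt (by omega), Nat.choose_eq_zero_of_lt]
      simp only [ht]; omega
  have htail : ∑ i : Fin (d + 1), (s i.succ - 1 - 1).choose (i.1 + 1) =
      ∑ i : Fin (d + 1), (t i.succ - 1).choose (i.1 + 1) := by
    refine Finset.sum_congr rfl fun i _ => ?_
    rcases le_total i.succ.1 (s i.succ - 1) with hi | hi
    · simp only [ht, max_eq_left hi]
    · rw [Fin.val_succ] at hi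
      rw [Nat.choose_eq_zero_of_lt (by omega), Nat.choose_eq_zero_of_lt]
      simp only [ht, Fin.val_succ]; omega
  have hu := macaulayLower_sum (s := fun i : Fin (d + 1) => s i.succ - 1) (fun i j hij => by
    have h1 := hs (Fin.succ_lt_succ_iff.mpr hij)
    have := hpos i
    simp only
    omega)
  have hb : ∑ i : Fin (d + 1 + 1), (t i).choose (i.1 + 1) = _ :=
    sum_choose_eq_add t fun i => by simp only [ht, Fin.val_succ]; omega
  have hlow := macaulayLower_sum htmono
  rw [hst] at hlt ha
  have h1 := macaulayLower_mono (d + 1)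
    (show ∑ i, (s i).choose (i.1 + 1) - b ≤
      ∑ i : Fin (d + 1), (s i.succ - 1).choose (i.1 + 1) by omega)
  rw [hu, htail] at h1
  have h2 := macaulayLower_le_add_sub (d + 1 + 1) (Nat.succ_le_of_lt hlt)
  simp only [Nat.succ_eq_add_one] at h2
  have h3 := (macaulayLower_succ_bounds (d + 1 + 1) (∑ i, (t i).choose (i.1 + 1))).2
  rcases Nat.eq_zero_or_pos (t 0) with h0 | h0
  · have h4 := macaulayLower_sum_add_one htmono h0
    omega
  · omega

section GeneralLinearForm

open Module MvPolynomial

variable {k : Type*} [Field k]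

theorem finrank_quotient_comap_add {V V' : Type*} [AddCommGroup V] [Module k V]
    [AddCommGroup V'] [Module k V'] [FiniteDimensional k V] [FiniteDimensional k V']
    (f : V →ₗ[k] V') (W : Submodule k V') :
    finrank k (V ⧸ W.comap f) + finrank k (V' ⧸ (W ⊔ LinearMap.range f)) =
      finrank k (V' ⧸ W) := by
  have h1 := LinearMap.finrank_range_add_finrank_ker (W.mkQ ∘ₗ f)
  rw [LinearMap.ker_comp, Submodule.ker_mkQ] at h1
  have h2 := (W.comap f).finrank_quotient_add_finrank
  have h3 := (LinearMap.range (W.mkQ ∘ₗ f)).finrank_quotient_add_finrank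
  have h4 : finrank k ((V' ⧸ W) ⧸ LinearMap.range (W.mkQ ∘ₗ f)) =
      finrank k (V' ⧸ (W ⊔ LinearMap.range f)) := by
    have e := (Submodule.quotientQuotientEquivQuotient W _
      (le_sup_left : W ≤ W ⊔ LinearMap.range f)).finrank_eq
    rw [← e, LinearMap.range_comp, Submodule.map_sup, Submodule.mkQ_map_self, bot_sup_eq]
  omega

/-- Lower semicontinuity of the rank in a linear family of linear maps. -/
theorem exists_eval_ne_zero_finrank_range_ge {ι V Q : Type*} [Fintype ι]
    [AddCommGroup V] [Module k V] [AddCommGroup Q] [Module k Q] [FiniteDimensional k Q]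
    (f : ι → V →ₗ[k] Q) (a : ι → k) :
    ∃ P : MvPolynomial ι k, eval a P ≠ 0 ∧ ∀ c : ι → k, eval c P ≠ 0 →
      finrank k (LinearMap.range (∑ i, a i • f i)) ≤
        finrank k (LinearMap.range (∑ i, c i • f i)) := by
  classical
  set R := LinearMap.range (∑ i, a i • f i)
  let b := finBasis k R
  choose v hv using fun j => LinearMap.mem_range.mp (b j).2
  obtain ⟨p, hp⟩ := LinearMap.exists_leftInverse_of_injective R.subtype R.ker_subtype
  let M : Matrix (Fin (finrank k R)) (Fin (finrank k R)) (MvPolynomial ι k) :=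
    Matrix.of fun i j => ∑ s, C (b.repr (p (f s (v j))) i) * X s
  have hM : ∀ c : ι → k, eval c M.det =
      (Matrix.of fun i j => b.repr (p ((∑ s, c s • f s) (v j))) i).det := by
    intro c
    rw [RingHom.map_det]
    congr 1
    ext i j
    simp [M, LinearMap.sum_apply, Finset.sum_apply', mul_comm]
  refine ⟨M.det, ?_, fun c hc => ?_⟩
  · have hpb : ∀ j, p (b j : Q) = b j := fun j => LinearMap.congr_fun hp (b j)
    rw [hM]
    have : (Matrix.of fun i j => b.repr (p ((∑ s, a s • f s) (v j))) i) = 1 := by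
      ext i j
      rw [Matrix.of_apply, hv, hpb, Basis.repr_self, Finsupp.single_apply, Matrix.one_apply]
      simp only [eq_comm]
    rw [this, Matrix.det_one]
    exact one_ne_zero
  · rw [hM] at hc
    have hli := Matrix.linearIndependent_cols_of_det_ne_zero hc
    have hli' : LinearIndependent k fun j => (∑ s, c s • f s) (v j) :=
      LinearIndependent.of_comp (b.equivFun.toLinearMap ∘ₗ p) hli
    have hli'' : LinearIndependent k fun j =>
        (⟨_, LinearMap.mem_range_self (∑ s, c s • f s) (v j)⟩ :
          LinearMap.range (∑ s, c s • f s)) :=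
      LinearIndependent.of_comp (Submodule.subtype _) hli'
    simpa using hli''.fintype_card_le_finrank

theorem exists_eval_ne_zero_finrank_quotient_le {ι V V' : Type*} [Fintype ι]
    [AddCommGroup V] [Module k V] [AddCommGroup V'] [Module k V'] [FiniteDimensional k V]
    [FiniteDimensional k V'] (f : ι → V →ₗ[k] V') (W : Submodule k V') (a : ι → k) :
    ∃ P : MvPolynomial ι k, eval a P ≠ 0 ∧ ∀ c : ι → k, eval c P ≠ 0 →
      finrank k (V' ⧸ (W ⊔ LinearMap.range (∑ i, c i • f i))) ≤
        finrank k (V' ⧸ (W ⊔ LinearMap.range (∑ i, a i • f i))) := by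
  obtain ⟨P, hP, h⟩ := exists_eval_ne_zero_finrank_range_ge (fun i => W.mkQ ∘ₗ f i) a
  refine ⟨P, hP, fun c hc => ?_⟩
  have key : ∀ c : ι → k, finrank k (LinearMap.range (∑ i, c i • (W.mkQ ∘ₗ f i))) =
      finrank k (V ⧸ W.comap (∑ i, c i • f i)) := by
    intro c
    have h1 := LinearMap.finrank_range_add_finrank_ker (W.mkQ ∘ₗ ∑ i, c i • f i)
    have h2 := (W.comap (∑ i, c i • f i)).finrank_quotient_add_finrank
    rw [LinearMap.ker_comp, Submodule.ker_mkQ] at h1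
    have h3 : (∑ i, c i • (W.mkQ ∘ₗ f i)) = W.mkQ ∘ₗ ∑ i, c i • f i := by
      ext x
      simp [LinearMap.sum_apply]
    rw [h3]
    omega
  have h1 := h c hc
  rw [key, key] at h1
  have h2 := finrank_quotient_comap_add (∑ i, c i • f i) W
  have h3 := finrank_quotient_comap_add (∑ i, a i • f i) W
  omega

/-- Green's bound for the restriction by a general linear combination of commuting degree-one
operators, on a graded vector space generated in degree zero by these operators. -/
theorem exists_general_finrank_quotient_le_macaulayLower [Infinite k] {ι : Type*} [Fintype ι]
    {V : ℕ → Type*} [∀ d, AddCommGroup (V d)] [∀ d, Module k (V d)]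
    [∀ d, FiniteDimensional k (V d)] (x : ∀ d, ι → V d →ₗ[k] V (d + 1))
    (hcomm : ∀ d i j v, x (d + 1) i (x d j v) = x (d + 1) j (x d i v))
    (hgen : ∀ d, ⨆ i, LinearMap.range (x d i) = ⊤) (d : ℕ) (W : Submodule k (V (d + 1))) :
    ∃ P : MvPolynomial ι k, P ≠ 0 ∧ ∀ c : ι → k, eval c P ≠ 0 →
      finrank k (V (d + 1) ⧸ (W ⊔ LinearMap.range (∑ i, c i • x d i))) ≤
        macaulayLower (d + 1) (finrank k (V (d + 1) ⧸ W)) := by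
  classical
  suffices h : ∃ a : ι → k, finrank k (V (d + 1) ⧸ (W ⊔ LinearMap.range (∑ i, a i • x d i))) ≤
      macaulayLower (d + 1) (finrank k (V (d + 1) ⧸ W)) by
    obtain ⟨a, ha⟩ := h
    obtain ⟨P, hP, h⟩ := exists_eval_ne_zero_finrank_quotient_le (x d) W a
    exact ⟨P, fun h0 => hP (by simp [h0]), fun c hc => (h c hc).trans ha⟩
  have exists_lt : ∀ (d : ℕ) (W : Submodule k (V (d + 1))), 0 < finrank k (V (d + 1) ⧸ W) →
      ∃ a : ι → k, finrank k (V (d + 1) ⧸ (W ⊔ LinearMap.range (∑ i, a i • x d i))) <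
        finrank k (V (d + 1) ⧸ W) := by
    intro d W hpos
    by_contra! hge
    have hle : ∀ i, LinearMap.range (x d i) ≤ W := by
      intro i
      have h1 := hge (Pi.single i 1)
      have h2 : ∑ j, (Pi.single i 1 : ι → k) j • x d j = x d i := by
        simp [Pi.single_apply]
      rw [h2] at h1
      have h3 := W.finrank_quotient_add_finrank
      have h4 := (W ⊔ LinearMap.range (x d i)).finrank_quotient_add_finrank
      have h5 := Submodule.eq_of_le_of_finrank_le
        (le_sup_left : W ≤ W ⊔ LinearMap.range (x d i)) (by omega)
      rw [h5]
      exact le_sup_right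
    have htop : W = ⊤ := top_le_iff.mp (hgen d ▸ iSup_le hle)
    have := W.finrank_quotient_add_finrank
    rw [htop, finrank_top] at this
    rw [htop] at hpos
    omega
  induction d with
  | zero =>
    rcases Nat.eq_zero_or_pos (finrank k (V (0 + 1) ⧸ W)) with h0 | hpos
    · refine ⟨0, ?_⟩
      have := finrank_quotient_comap_add (∑ i, (0 : ι → k) i • x 0 i) W
      omega
    · obtain ⟨a, ha⟩ := exists_lt 0 W hpos
      refine ⟨a, ?_⟩
      rw [macaulayLower_one]
      omega
  | succ d ihd =>
    induction hc : finrank k (V (d + 1 + 1) ⧸ W) using Nat.strong_induction_on generalizing W with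
    | _ c ihc =>
    subst hc
    rcases Nat.eq_zero_or_pos (finrank k (V (d + 1 + 1) ⧸ W)) with h0 | hpos
    · refine ⟨0, ?_⟩
      have := finrank_quotient_comap_add (∑ i, (0 : ι → k) i • x (d + 1) i) W
      omega
    set g : (ι → k) → ℕ := fun a =>
      finrank k (V (d + 1 + 1) ⧸ (W ⊔ LinearMap.range (∑ i, a i • x (d + 1) i)))
    obtain ⟨a, hmin⟩ : ∃ a, ∀ c, g a ≤ g c :=
      ⟨Function.argmin g, fun c => Function.argmin_le g c⟩
    have hlt : g a < finrank k (V (d + 1 + 1) ⧸ W) := by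
      obtain ⟨c, hc⟩ := exists_lt (d + 1) W hpos
      exact (hmin c).trans_lt hc
    refine ⟨a, ?_⟩
    set l := ∑ i, a i • x (d + 1) i with hl
    set l' := ∑ i, a i • x d i with hl'
    obtain ⟨b₁, hb₁⟩ := ihc (g a) hlt (W ⊔ LinearMap.range l) rfl
    obtain ⟨P₁, hP₁, h₁⟩ := exists_eval_ne_zero_finrank_quotient_le (x (d + 1))
      (W ⊔ LinearMap.range l) b₁
    obtain ⟨b₂, hb₂⟩ := ihd (W.comap l)
    obtain ⟨P₂, hP₂, h₂⟩ := exists_eval_ne_zero_finrank_quotient_le (x d) (W.comap l) b₂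
    obtain ⟨P₀, hP₀, h₀⟩ := exists_eval_ne_zero_finrank_quotient_le (x (d + 1)) W a
    have hne : P₀ * P₁ * P₂ ≠ 0 := by
      refine mul_ne_zero (mul_ne_zero ?_ ?_) ?_ <;> rintro rfl <;> simp_all
    obtain ⟨c, hc⟩ : ∃ c, eval c (P₀ * P₁ * P₂) ≠ 0 := by
      by_contra! h
      exact hne (MvPolynomial.funext fun c => by simpa using h c)
    simp only [map_mul, mul_ne_zero_iff] at hc
    have hc₀ : g c ≤ g a := h₀ c hc.1.1
    have hc₁ := (h₁ c hc.1.2).trans hb₁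
    have hc₂ := (h₂ c hc.2).trans hb₂
    set m := ∑ i, c i • x (d + 1) i with hm
    set m' := ∑ i, c i • x d i with hm'
    have hlm : ∀ v, l (m' v) = m (l' v) := by
      intro v
      simp only [hl, hm, hl', hm', LinearMap.sum_apply, LinearMap.smul_apply, map_sum, map_smul,
        Finset.smul_sum]
      rw [Finset.sum_comm]
      refine Finset.sum_congr rfl fun i _ => Finset.sum_congr rfl fun j _ => ?_
      rw [hcomm, smul_comm]
    have hsub : W.comap l ⊔ LinearMap.range m' ≤ (W ⊔ LinearMap.range m).comap l := by
      refine sup_le (Submodule.comap_mono le_sup_left) ?_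
      rintro _ ⟨v, rfl⟩
      rw [Submodule.mem_comap, hlm]
      exact le_sup_right (a := W) (LinearMap.mem_range_self m _)
    have e₁ := finrank_quotient_comap_add l W
    have e₂ := finrank_quotient_comap_add l (W ⊔ LinearMap.range m)
    have e₃ := ((W ⊔ LinearMap.range m).comap l).finrank_quotient_add_finrank
    have e₄ := (W.comap l ⊔ LinearMap.range m').finrank_quotient_add_finrank
    have e₅ := Submodule.finrank_mono hsub
    rw [sup_right_comm] at e₂
    have hla : finrank k (V (d + 1 + 1) ⧸ (W ⊔ LinearMap.range l)) = g a := rfl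
    have hmc : finrank k (V (d + 1 + 1) ⧸ (W ⊔ LinearMap.range m)) = g c := rfl
    have hca : g c = g a := le_antisymm hc₀ (hmin c)
    rw [show finrank k (V (d + 1) ⧸ W.comap l) = finrank k (V (d + 1 + 1) ⧸ W) - g a by omega]
      at hc₂
    rw [hla]
    exact le_macaulayLower_of_sub_le hlt.le (by omega)

end GeneralLinearForm

theorem finrank_range_sub_finrank_map_le {k V Q : Type*} [Field k] [AddCommGroup V] [Module k V]
    [AddCommGroup Q] [Module k Q] [FiniteDimensional k V] (g : V →ₗ[k] Q) {W U : Submodule k V}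
    (h : U.map g ≤ W.map g) :
    Module.finrank k (LinearMap.range g) - Module.finrank k (W.map g) ≤
      Module.finrank k (V ⧸ U) := by
  obtain ⟨U', hU'⟩ := U.exists_isCompl
  have h1 : LinearMap.range g ≤ W.map g ⊔ U'.map g := by
    rw [LinearMap.range_eq_map, ← hU'.sup_eq_top, Submodule.map_sup]
    exact sup_le_sup_right h _
  have h2 := (Submodule.finrank_mono h1).trans (Submodule.finrank_add_le_finrank_add_finrank _ _)
  have h3 := Submodule.finrank_map_le g U'
  have h4 := (Submodule.quotientEquivOfIsCompl U U' hU').finrank_eq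
  omega

namespace MvPolynomial

variable {σ k : Type*}

/-- Multiplication by a variable, as a map between graded components. -/
noncomputable def homogeneousMulX [CommRing k] (d : ℕ) (i : σ) :
    homogeneousSubmodule σ k d →ₗ[k] homogeneousSubmodule σ k (d + 1) :=
  (LinearMap.mulRight k (X i : MvPolynomial σ k)).restrict
    fun _ hp => IsHomogeneous.mul hp (isHomogeneous_X k i)

@[simp]
theorem coe_homogeneousMulX [CommRing k] (d : ℕ) (i : σ) (p : homogeneousSubmodule σ k d) :
    (homogeneousMulX d i p : MvPolynomial σ k) = (p : MvPolynomial σ k) * X i :=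
  rfl

theorem iSup_range_homogeneousMulX [CommRing k] (d : ℕ) :
    ⨆ i : σ, LinearMap.range (homogeneousMulX (k := k) d i) = ⊤ := by
  rw [← Submodule.map_injective_of_injective
    (homogeneousSubmodule σ k (d + 1)).injective_subtype |>.eq_iff, Submodule.map_subtype_top]
  refine le_antisymm (Submodule.map_subtype_le _ _) ?_
  intro p hp
  rw [p.as_sum]
  refine Submodule.sum_mem _ fun e he => ?_
  have hdeg : e.degree = d + 1 := by
    by_contra hne
    exact mem_support_iff.mp he (IsHomogeneous.coeff_eq_zero hp hne)
  obtain ⟨i, hi⟩ : ∃ i, e i ≠ 0 := by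
    by_contra! h
    rw [show e = 0 from Finsupp.ext h] at hdeg
    simp at hdeg
  have hle : Finsupp.single i 1 ≤ e := by
    rw [Finsupp.single_le_iff]; omega
  have hdeg' : (e - Finsupp.single i 1).degree = d := by
    have := congrArg Finsupp.degree (tsub_add_cancel_of_le hle)
    rw [map_add, Finsupp.degree_single] at this
    omega
  refine ⟨homogeneousMulX d i ⟨monomial (e - Finsupp.single i 1) (coeff e p),
    isHomogeneous_monomial _ hdeg'⟩, ?_, ?_⟩
  · exact Submodule.mem_iSup_of_mem i (LinearMap.mem_range_self _ _)
  · simp [X, monomial_mul, tsub_add_cancel_of_le hle]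

end MvPolynomial

open MvPolynomial

/-- **Green's hyperplane restriction theorem.** Let `k` be an algebraically closed field,
`S = k[x_0, …, x_n]`, `S_d` the space of degree-`d` homogeneous polynomials, and `W ⊆ S_d`
a subspace of codimension `c = dim S_d - dim W`, whose `d`-th Macaulay representation
`c = C(k_d, d) + ⋯ + C(k_1, 1)` (`k_d > ⋯ > k_1 ≥ 0`) is encoded by the strictly monotone
`kseq : Fin d → ℕ`.  Then there is a nonempty Zariski-open subset of the space of linear
forms — encoded, after identifying a linear form `l = a_0 x_0 + ⋯ + a_n x_n` with its tuple
of coefficients `(a_0, …, a_n)`, as the complement of the zero locus of a nonzero polynomial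
`P` in the coefficients — such that for every linear form `l` in it, the image `W_l` of `W`
under the quotient map `S_d → (S/(l))_d` has codimension `c_l ≤ c_{<d>}` in `(S/(l))_d`,
where `c_{<d>} = C(k_d-1, d) + ⋯ + C(k_1-1, 1)` (by convention `0_{<d>} = 0`). -/
theorem green_hyperplane_restriction (k : Type*) [Field k] [IsAlgClosed k] (n d : ℕ)
    (hd : 1 ≤ d) (W : Submodule k (MvPolynomial (Fin (n + 1)) k))
    (hW : W ≤ homogeneousSubmodule (Fin (n + 1)) k d)
    (kseq : Fin d → ℕ) (hmono : StrictMono kseq)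
    (hrep : Module.finrank k (homogeneousSubmodule (Fin (n + 1)) k d) - Module.finrank k W
      = ∑ i : Fin d, Nat.choose (kseq i) (i.1 + 1)) :
    ∃ P : MvPolynomial (Fin (n + 1)) k, P ≠ 0 ∧
      ∀ a : Fin (n + 1) → k, MvPolynomial.eval a P ≠ 0 →
        Module.finrank k
            (Submodule.map
              (Ideal.Quotient.mkₐ k
                (Ideal.span {(∑ i : Fin (n + 1), C (a i) * X i :
                  MvPolynomial (Fin (n + 1)) k)})).toLinearMap
              (homogeneousSubmodule (Fin (n + 1)) k d)) -
          Module.finrank k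
            (Submodule.map
              (Ideal.Quotient.mkₐ k
                (Ideal.span {(∑ i : Fin (n + 1), C (a i) * X i :
                  MvPolynomial (Fin (n + 1)) k)})).toLinearMap
              W)
          ≤ ∑ i : Fin d, Nat.choose (kseq i - 1) (i.1 + 1) := by
  obtain ⟨d, rfl⟩ := Nat.exists_eq_add_of_le' hd
  have : ∀ e, FiniteDimensional k (homogeneousSubmodule (Fin (n + 1)) k e) := fun e =>
    Module.Finite.iff_fg.mpr (homogeneousSubmodule_fg (Fin (n + 1)) k e)
  set B := homogeneousSubmodule (Fin (n + 1)) k (d + 1)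
  obtain ⟨P, hP, h⟩ := exists_general_finrank_quotient_le_macaulayLower
    (V := fun e => homogeneousSubmodule (Fin (n + 1)) k e) (homogeneousMulX (k := k))
    (fun e i j v => Subtype.ext (mul_right_comm _ _ _)) iSup_range_homogeneousMulX d
    (W.comap B.subtype)
  refine ⟨P, hP, fun a ha => ?_⟩
  have hW' : (W.comap B.subtype).map B.subtype = W := by
    rw [Submodule.map_comap_subtype, inf_eq_right.mpr hW]
  have hcodim : Module.finrank k (B ⧸ W.comap B.subtype) =
      ∑ i : Fin (d + 1), (kseq i).choose (i.1 + 1) := by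
    have h1 := (W.comap B.subtype).finrank_quotient_add_finrank
    have h2 := LinearEquiv.finrank_eq (Submodule.comapSubtypeEquivOfLe hW)
    omega
  refine le_trans ?_ ((h a ha).trans_eq (by rw [hcodim, macaulayLower_sum hmono]))
  set q := (Ideal.Quotient.mkₐ k (Ideal.span {(∑ i : Fin (n + 1), C (a i) * X i :
    MvPolynomial (Fin (n + 1)) k)})).toLinearMap
  have hB : B.map q = LinearMap.range (q ∘ₗ B.subtype) := by
    rw [LinearMap.range_comp, Submodule.range_subtype]
  have hWq : W.map q = (W.comap B.subtype).map (q ∘ₗ B.subtype) := by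
    rw [Submodule.map_comp, hW']
  rw [hB, hWq]
  refine finrank_range_sub_finrank_map_le _ ?_
  rw [Submodule.map_sup]
  refine sup_le le_rfl ?_
  rintro _ ⟨_, ⟨p, rfl⟩, rfl⟩
  convert Submodule.zero_mem _
  change Ideal.Quotient.mk _ _ = 0
  rw [Ideal.Quotient.eq_zero_iff_mem, Ideal.mem_span_singleton]
  refine ⟨p, ?_⟩
  rw [mul_comm, Finset.mul_sum]
  simp [LinearMap.sum_apply, smul_eq_C_mul, mul_left_comm]
end

section
/- Let A be a commutative ring, n \ge 0, and S_A = A[x_0, ..., x_n] with S_{A,d} its degree-d homogeneous component; let \mu_i denote multiplication by the variable x_i. Let R \ge 1, let P and P' be A-modules, let \rho : S_{A,R} \to P be an A-linear map, and let M_0, ..., M_n : P \to P' be A-linear maps satisfying the commutation relations M_i \circ \rho \circ \mu_j = M_j \circ \rho \circ \mu_i on S_{A,R-1} for every pair (i,j). Then there exists a unique A-linear map \beta : S_{A,R+1} \to P' such that \beta(x_i f) = M_i(\rho(f)) for every i \in \{0, ..., n\} and every f \in S_{A,R}. -/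
open MvPolynomial

/-- Multiplication by the variable `x_i`, as a linear map
`S_{A,d} → S_{A,d+1}` between homogeneous components of `S_A = A[x_0, …, x_n]`. -/
noncomputable def mulVar (A : Type*) [CommRing A] (n d : ℕ) (i : Fin (n + 1)) :
    ↥(homogeneousSubmodule (Fin (n + 1)) A d) →ₗ[A]
      ↥(homogeneousSubmodule (Fin (n + 1)) A (d + 1)) :=
  LinearMap.restrict (LinearMap.mulLeft A (X i))
    (fun p hp => by
      rw [mem_homogeneousSubmodule] at hp ⊢
      simpa [add_comm] using (isHomogeneous_X A i).mul hp)

namespace MvPolynomial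

/-- Linear maps `φ i` on a polynomial ring satisfying `φ i (X j * g) = φ j (X i * g)` are of the
form `f ↦ B (X i * f)` for a single linear map `B`. -/
theorem exists_linearMap_apply_X_mul {σ A N : Type*} [CommRing A] [AddCommGroup N] [Module A N]
    (φ : σ → MvPolynomial σ A →ₗ[A] N)
    (hφ : ∀ i j g, φ i (X j * g) = φ j (X i * g)) :
    ∃ B : MvPolynomial σ A →ₗ[A] N, ∀ i f, B (X i * f) = φ i f := by
  classical
  let B : MvPolynomial σ A →ₗ[A] N := (basisMonomials σ A).constr A fun m =>
    if h : ∃ k m', m = Finsupp.single k 1 + m' then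
      φ h.choose (monomial h.choose_spec.choose 1) else 0
  refine ⟨B, fun i f => ?_⟩
  suffices H : B ∘ₗ LinearMap.mulLeft A (X i) = φ i from LinearMap.congr_fun H f
  refine (basisMonomials σ A).ext fun m => ?_
  have hX (k : σ) (m : σ →₀ ℕ) :
      X k * monomial m (1 : A) = monomial (Finsupp.single k 1 + m) 1 := by
    simp [X, monomial_mul]
  have hm : ∃ k m', Finsupp.single i 1 + m = Finsupp.single k 1 + m' := ⟨i, m, rfl⟩
  have hB : B (monomial (Finsupp.single i 1 + m) 1) =
      φ hm.choose (monomial hm.choose_spec.choose 1) := by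
    exact ((basisMonomials σ A).constr_basis A _ _).trans (dif_pos hm)
  have hspec := hm.choose_spec.choose_spec
  simp only [coe_basisMonomials, LinearMap.comp_apply, LinearMap.mulLeft_apply]
  rw [hX, hB]
  generalize hm.choose_spec.choose = m' at hspec ⊢
  generalize hm.choose = k at hspec ⊢
  by_cases hki : k = i
  · subst hki
    rw [add_left_cancel hspec]
  · have hle : Finsupp.single k 1 ≤ m := by
      have := DFunLike.congr_fun hspec k
      rw [Finsupp.single_le_iff]
      simp [Ne.symm hki] at this
      omega
    obtain ⟨l, rfl⟩ := exists_add_of_le hle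
    rw [add_left_comm] at hspec
    rw [← add_left_cancel hspec, ← hX, ← hX, hφ]

/-- The projection of the polynomial ring onto its homogeneous component of degree `d`. -/
noncomputable def homogeneousProj (σ A : Type*) [CommRing A] (d : ℕ) :
    MvPolynomial σ A →ₗ[A] ↥(homogeneousSubmodule σ A d) :=
  (homogeneousComponent d).codRestrict _ fun p => homogeneousComponent_mem d p

theorem homogeneousProj_coe {σ A : Type*} [CommRing A] {d : ℕ}
    (f : ↥(homogeneousSubmodule σ A d)) : homogeneousProj σ A d f = f :=
  Subtype.ext ((homogeneousComponent_of_mem f.2).trans (if_pos rfl))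

theorem homogeneousProj_X_mul {A : Type*} [CommRing A] (n d : ℕ) (i : Fin (n + 1))
    (g : MvPolynomial (Fin (n + 1)) A) :
    homogeneousProj _ A (d + 1) (X i * g) = mulVar A n d i (homogeneousProj _ A d g) := by
  ext m
  change coeff m (homogeneousComponent (d + 1) (X i * g)) =
    coeff m (X i * homogeneousComponent d g)
  rw [coeff_homogeneousComponent, coeff_X_mul', coeff_X_mul', coeff_homogeneousComponent]
  by_cases hi : i ∈ m.support
  · have hle : Finsupp.single i 1 ≤ m := by
      rw [Finsupp.single_le_iff]
      exact Nat.one_le_iff_ne_zero.mpr (Finsupp.mem_support_iff.mp hi)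
    obtain ⟨l, rfl⟩ := exists_add_of_le hle
    simp [hi, add_comm d 1]
  · simp [hi]

/-- A linear map out of a homogeneous component of positive degree is determined by its
composites with the multiplications by the variables. -/
theorem linearMap_ext_mulVar {A N : Type*} [CommRing A] [AddCommGroup N] [Module A N] {n d : ℕ}
    {β γ : ↥(homogeneousSubmodule (Fin (n + 1)) A (d + 1)) →ₗ[A] N}
    (h : ∀ i, β ∘ₗ mulVar A n d i = γ ∘ₗ mulVar A n d i) : β = γ := by
  suffices H : β ∘ₗ homogeneousProj _ A (d + 1) = γ ∘ₗ homogeneousProj _ A (d + 1) by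
    ext f
    simpa [homogeneousProj_coe] using LinearMap.congr_fun H (f : MvPolynomial (Fin (n + 1)) A)
  refine (basisMonomials _ A).ext fun m => ?_
  simp only [coe_basisMonomials, LinearMap.comp_apply]
  obtain rfl | hm := eq_or_ne m 0
  · have h0 : homogeneousProj (Fin (n + 1)) A (d + 1) (monomial 0 1) = 0 :=
      Subtype.ext ((homogeneousComponent_of_mem (isHomogeneous_one _ _)).trans
        (if_neg d.succ_ne_zero))
    rw [h0, map_zero, map_zero]
  · obtain ⟨i, hi⟩ := Finsupp.ne_iff.mp hm
    obtain ⟨l, rfl⟩ := exists_add_of_le (show Finsupp.single i 1 ≤ m by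
      rw [Finsupp.single_le_iff]
      exact Nat.one_le_iff_ne_zero.mpr hi)
    have hX : monomial (Finsupp.single i 1 + l) (1 : A) = X i * monomial l 1 := by
      simp [X, monomial_mul]
    rw [hX, homogeneousProj_X_mul]
    exact LinearMap.congr_fun (h i) _

end MvPolynomial

/-- Let `A` be a commutative ring, `S_A = A[x_0, …, x_n]`, `R ≥ 1` (written `R = Rm + 1`),
`P` and `P'` two `A`-modules, `ρ : S_{A,R} → P` an `A`-linear map and `M_0, …, M_n : P → P'`
`A`-linear maps satisfying the commutation relations `M_i ∘ ρ ∘ μ_j = M_j ∘ ρ ∘ μ_i` on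
`S_{A,R-1}` for all `i, j`, where `μ_i` is multiplication by `x_i`.  Then there is a unique
`A`-linear map `β : S_{A,R+1} → P'` with `β (x_i * f) = M_i (ρ f)` for every `i` and every
`f ∈ S_{A,R}`. -/
theorem exists_unique_beta {A : Type*} [CommRing A] (n Rm : ℕ)
    {P P' : Type*} [AddCommGroup P] [Module A P] [AddCommGroup P'] [Module A P']
    (ρ : ↥(homogeneousSubmodule (Fin (n + 1)) A (Rm + 1)) →ₗ[A] P)
    (M : Fin (n + 1) → (P →ₗ[A] P'))
    (hcomm : ∀ i j : Fin (n + 1),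
      (M i) ∘ₗ ρ ∘ₗ mulVar A n Rm j = (M j) ∘ₗ ρ ∘ₗ mulVar A n Rm i) :
    ∃! β : ↥(homogeneousSubmodule (Fin (n + 1)) A (Rm + 2)) →ₗ[A] P',
      ∀ i : Fin (n + 1), β ∘ₗ mulVar A n (Rm + 1) i = (M i) ∘ₗ ρ := by
  obtain ⟨B, hB⟩ := exists_linearMap_apply_X_mul
    (fun i => M i ∘ₗ ρ ∘ₗ homogeneousProj _ A (Rm + 1)) fun i j g => by
      simpa [homogeneousProj_X_mul] using LinearMap.congr_fun (hcomm i j) (homogeneousProj _ A Rm g)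
  refine ⟨B ∘ₗ Submodule.subtype _, fun i => LinearMap.ext fun f => ?_, fun γ hγ => ?_⟩
  · exact (hB i f).trans (by simp [homogeneousProj_coe])
  · refine linearMap_ext_mulVar fun i => (hγ i).trans (LinearMap.ext fun f => ?_)
    exact ((hB i f).trans (by simp [homogeneousProj_coe])).symm
end

section
/- Let A be a commutative ring, n \ge 0, S_A = A[x_0, ..., x_n], and let R, p, q be integers with q \ge p+1. Let I_R \subseteq S_{A,R} and I_{R+1} \subseteq S_{A,R+1} be A-submodules such that S_{A,R}/I_R is a free A-module of rank p, S_{A,R+1}/I_{R+1} is a free A-module of rank q, and x_i \cdot I_R \subseteq I_{R+1} for every variable x_i. Then for every \ell \in S_{A,1}, every z_1, ..., z_{p+1} \in S_{A,R} and every v_1, ..., v_{q-p-1} \in S_{A,R+1}, the wedge product of the classes of \ell z_1, \ell z_2, ..., \ell z_{p+1}, v_1, ..., v_{q-p-1} in the q-th exterior power \Lambda^q_A (S_{A,R+1}/I_{R+1}) is zero. -/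
open MvPolynomial

/-- The product of a linear form `ℓ ∈ S_{A,1}` and an element `z ∈ S_{A,R}`, as an element
of `S_{A,R+1}`, where `S_{A,d}` is the degree-`d` homogeneous component of
`S_A = A[x_0, …, x_n]`. -/
noncomputable def linMul {A : Type*} [CommRing A] {n R : ℕ}
    (ℓ : ↥(homogeneousSubmodule (Fin (n + 1)) A 1))
    (z : ↥(homogeneousSubmodule (Fin (n + 1)) A R)) :
    ↥(homogeneousSubmodule (Fin (n + 1)) A (R + 1)) :=
  ⟨(ℓ : MvPolynomial (Fin (n + 1)) A) * (z : MvPolynomial (Fin (n + 1)) A), by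
    have hℓ := ℓ.2
    have hz := z.2
    rw [mem_homogeneousSubmodule] at hℓ hz ⊢
    simpa [add_comm] using hℓ.mul hz⟩

/-- An alternating map in more variables than the size of a basis of its source vanishes. -/
theorem AlternatingMap.eq_zero_of_basis_of_card_lt {R M N ι κ : Type*} [CommSemiring R]
    [AddCommMonoid M] [Module R M] [AddCommMonoid N] [Module R N] [Fintype ι] [Fintype κ]
    (b : Module.Basis κ R M) (h : Fintype.card κ < Fintype.card ι) (f : M [⋀^ι]→ₗ[R] N) :
    f = 0 :=
  b.ext_alternating fun v hv => absurd (Fintype.card_le_of_injective v hv) h.not_ge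

/-- Multiplication by a linear form, as a linear map `S_{A,R} → S_{A,R+1}`. -/
noncomputable def linMulLeft {A : Type*} [CommRing A] {n R : ℕ}
    (ℓ : ↥(homogeneousSubmodule (Fin (n + 1)) A 1)) :
    ↥(homogeneousSubmodule (Fin (n + 1)) A R) →ₗ[A]
      ↥(homogeneousSubmodule (Fin (n + 1)) A (R + 1)) where
  toFun := linMul ℓ
  map_add' _ _ := Subtype.ext (mul_add _ _ _)
  map_smul' _ _ := Subtype.ext (mul_smul_comm _ _ _)

/-- Multiplication by a linear form is a linear combination of the multiplications by the
variables. -/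
theorem exists_linMulLeft_eq_sum {A : Type*} [CommRing A] {n R : ℕ}
    (ℓ : ↥(homogeneousSubmodule (Fin (n + 1)) A 1)) :
    ∃ c : Fin (n + 1) → A, linMulLeft (R := R) ℓ = ∑ i, c i • mulVar A n R i := by
  obtain ⟨c, hc⟩ := (Submodule.mem_span_range_iff_exists_fun A).1
    (homogeneousSubmodule_one_eq_span_X.le ℓ.2)
  refine ⟨c, LinearMap.ext fun z => Subtype.ext ?_⟩
  change (ℓ : MvPolynomial (Fin (n + 1)) A) * (z : MvPolynomial (Fin (n + 1)) A) = _
  simp [← hc, Finset.sum_mul, LinearMap.sum_apply, mulVar]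

set_option synthInstance.maxHeartbeats 1000000 in
/-- Let `A` be a commutative ring, `S_A = A[x_0, …, x_n]`, and `R, p, q` integers with
`q ≥ p + 1` (written `q = p + 1 + s`).  Let `I_R ⊆ S_{A,R}` and `I_{R+1} ⊆ S_{A,R+1}` be
`A`-submodules such that `S_{A,R}/I_R` is free of rank `p`, `S_{A,R+1}/I_{R+1}` is free of
rank `q`, and `x_i · I_R ⊆ I_{R+1}` for every variable `x_i`.  Then for every linear form
`ℓ ∈ S_{A,1}`, all `z_1, …, z_{p+1} ∈ S_{A,R}` and all `v_1, …, v_{q-p-1} ∈ S_{A,R+1}`, the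
wedge product of the classes of `ℓz_1, …, ℓz_{p+1}, v_1, …, v_{q-p-1}` in the `q`-th exterior
power `Λ^q (S_{A,R+1}/I_{R+1})` vanishes (stated via the alternating map `ιMulti` with values
in the exterior algebra, in which the `q`-th exterior power embeds). -/
theorem wedge_vanishing {A : Type*} [CommRing A] (n R p s : ℕ)
    (IR : Submodule A ↥(homogeneousSubmodule (Fin (n + 1)) A R))
    (IR1 : Submodule A ↥(homogeneousSubmodule (Fin (n + 1)) A (R + 1)))
    (hfreeR : Nonempty ((↥(homogeneousSubmodule (Fin (n + 1)) A R) ⧸ IR) ≃ₗ[A]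
      (Fin p → A)))
    (hfreeR1 : Nonempty ((↥(homogeneousSubmodule (Fin (n + 1)) A (R + 1)) ⧸ IR1) ≃ₗ[A]
      (Fin (p + 1 + s) → A)))
    (hmul : ∀ i : Fin (n + 1), IR.map (mulVar A n R i) ≤ IR1)
    (ℓ : ↥(homogeneousSubmodule (Fin (n + 1)) A 1))
    (z : Fin (p + 1) → ↥(homogeneousSubmodule (Fin (n + 1)) A R))
    (v : Fin s → ↥(homogeneousSubmodule (Fin (n + 1)) A (R + 1))) :
    ExteriorAlgebra.ιMulti A (p + 1 + s)
      (Fin.append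
        (fun i : Fin (p + 1) => Submodule.Quotient.mk (p := IR1) (linMul ℓ (z i)))
        (fun j : Fin s => Submodule.Quotient.mk (p := IR1) (v j))) = 0 := by
  obtain ⟨e⟩ := hfreeR
  have hle : IR ≤ IR1.comap (linMulLeft ℓ) := fun w hw => by
    obtain ⟨c, hc⟩ := exists_linMulLeft_eq_sum (R := R) ℓ
    rw [Submodule.mem_comap, hc, LinearMap.sum_apply]
    exact IR1.sum_mem fun i _ => IR1.smul_mem _ (hmul i (Submodule.mem_map_of_mem hw))
  have hzero : (ExteriorAlgebra.ιMulti A (p + 1)).compLinearMap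
      (IR.mapQ IR1 (linMulLeft ℓ) hle) = 0 :=
    AlternatingMap.eq_zero_of_basis_of_card_lt (Module.Basis.ofEquivFun e) (by simp) _
  have hz : ExteriorAlgebra.ιMulti A (p + 1)
      (fun i => Submodule.Quotient.mk (p := IR1) (linMul ℓ (z i))) = 0 :=
    DFunLike.congr_fun hzero fun i => Submodule.Quotient.mk (z i)
  rw [← ExteriorAlgebra.ιMulti_mul_ιMulti, hz, zero_mul]
end

section
/- Let A be a commutative ring and M a finitely generated A-module, and let i \ge 1 be an integer. Then the i-th exterior power \Lambda^i_A M is zero if and only if for every maximal ideal \mathfrak{m} of A, the A/\mathfrak{m}-vector space M/\mathfrak{m}M has dimension at most i-1 (equivalently, the localization M_{\mathfrak{m}} is generated by i-1 elements). -/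
/-- Over an algebra, the determinant is alternating in its rows over the base ring. -/
noncomputable def Matrix.detRowAlternatingOver (A K : Type*) [CommRing A] [CommRing K] [Algebra A K]
    (n : ℕ) : (Fin n → K) [⋀^Fin n]→ₗ[A] K :=
  { (Matrix.detRowAlternating (R := K) (n := Fin n)).toMultilinearMap.restrictScalars A with
    map_eq_zero_of_eq' := fun v _ _ h hij ↦
      (Matrix.detRowAlternating (R := K) (n := Fin n)).map_eq_zero_of_eq v h hij }

lemma Matrix.detRowAlternatingOver_apply (A : Type*) {K : Type*} [CommRing A] [CommRing K]
    [Algebra A K] {n : ℕ} (v : Fin n → Fin n → K) :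
    Matrix.detRowAlternatingOver A K n v = Matrix.det (Matrix.of v) := rfl

/-- If the `n`-th exterior power of `M` vanishes, so does every alternating map of `n` variables
on `M`. -/
lemma AlternatingMap.eq_zero_of_exteriorPower_eq_bot {A M N : Type*} [CommRing A]
    [AddCommGroup M] [Module A M] [AddCommGroup N] [Module A N] {n : ℕ}
    (h : ⋀[A]^n M = ⊥) (f : M [⋀^Fin n]→ₗ[A] N) : f = 0 := by
  ext v
  have hv : exteriorPower.ιMulti A n v = 0 :=
    Subtype.ext ((Submodule.mem_bot A).1 (h ▸ (exteriorPower.ιMulti A n v).2))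
  rw [← exteriorPower.alternatingMapLinearEquiv_apply_ιMulti f v, hv, _root_.map_zero, zero_apply]

/-- An alternating map in more variables than there are generators vanishes. -/
lemma AlternatingMap.eq_zero_of_span_eq_top {A M N : Type*} [CommRing A]
    [AddCommGroup M] [Module A M] [AddCommGroup N] [Module A N] {d n : ℕ} (hdn : d < n)
    {w : Fin d → M} (hw : Submodule.span A (Set.range w) = ⊤) (f : M [⋀^Fin n]→ₗ[A] N) :
    f = 0 := by
  refine f.eq_zero_of_exteriorPower_eq_bot ?_
  have hempty : IsEmpty (Set.powersetCard (Fin d) n) := by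
    refine ⟨fun s ↦ ?_⟩
    have h₁ := s.2
    have h₂ := Finset.card_le_univ s.1
    rw [Set.powersetCard.mem_iff] at h₁
    simp only [Fintype.card_fin] at h₂
    omega
  rw [← exteriorPower.ιMulti_family_span_fixedDegree_of_span A hw, Set.range_eq_empty,
    Submodule.span_empty]

/-- If `M` surjects onto a free module of rank `n` over a nontrivial algebra, then the `n`-th
exterior power of `M` does not vanish. -/
lemma exteriorPower_ne_bot_of_surjective {A K M : Type*} [CommRing A] [CommRing K] [Nontrivial K]
    [Algebra A K] [AddCommGroup M] [Module A M] {n : ℕ} (g : M →ₗ[A] (Fin n → K))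
    (hg : Function.Surjective g) : ⋀[A]^n M ≠ ⊥ := by
  intro h
  choose m hm using fun j : Fin n ↦ hg (Pi.single j 1)
  have hdet := DFunLike.congr_fun (AlternatingMap.eq_zero_of_exteriorPower_eq_bot h
    ((Matrix.detRowAlternatingOver A K n).compLinearMap g)) m
  have hone : Matrix.of (fun j ↦ g (m j)) = (1 : Matrix (Fin n) (Fin n) K) := by
    ext j k
    simp [hm, Matrix.one_apply, Pi.single_apply, eq_comm]
  rw [AlternatingMap.compLinearMap_apply, Matrix.detRowAlternatingOver_apply] at hdet
  change (Matrix.of (fun j ↦ g (m j))).det = 0 at hdet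
  rw [hone, Matrix.det_one] at hdet
  exact one_ne_zero hdet

/-- If `r • M` lies in a submodule generated by fewer than `n` elements, then `r ^ n` kills every
alternating map of `n` variables on `M`. -/
lemma AlternatingMap.pow_smul_eq_zero {A M N : Type*} [CommRing A]
    [AddCommGroup M] [Module A M] [AddCommGroup N] [Module A N] {d n : ℕ} (hdn : d < n)
    {w : Fin d → M} {r : A} (hr : ∀ m : M, r • m ∈ Submodule.span A (Set.range w))
    (f : M [⋀^Fin n]→ₗ[A] N) (v : Fin n → M) : r ^ n • f v = 0 := by
  have hspan := (Submodule.span_range_subtype_eq_top_iff (Submodule.span A (Set.range w))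
    fun j ↦ Submodule.subset_span (Set.mem_range_self j)).2 rfl
  have hw := AlternatingMap.eq_zero_of_span_eq_top hdn hspan
    (f.compLinearMap (Submodule.span A (Set.range w)).subtype)
  have hv := DFunLike.congr_fun hw fun j ↦ ⟨r • v j, hr (v j)⟩
  have hsmul := f.toMultilinearMap.map_smul_univ (fun _ ↦ r) v
  rw [Finset.prod_const, Finset.card_univ, Fintype.card_fin] at hsmul
  exact hsmul.symm.trans hv

/-- Nakayama's lemma at a maximal ideal: up to multiplication by an element outside `𝔪`, a finite
module is generated by as many elements as the dimension of its fibre at `𝔪`. -/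
lemma Ideal.IsMaximal.exists_notMem_smul_mem_span {A M : Type*} [CommRing A]
    [AddCommGroup M] [Module A M] [Module.Finite A M] {𝔪 : Ideal A} (h𝔪 : 𝔪.IsMaximal) :
    ∃ (w : Fin (Module.finrank (A ⧸ 𝔪) (M ⧸ (𝔪 • ⊤ : Submodule A M))) → M) (r : A), r ∉ 𝔪 ∧
      ∀ m : M, r • m ∈ Submodule.span A (Set.range w) := by
  let _ := Ideal.Quotient.field 𝔪
  have : Module.Finite (A ⧸ 𝔪) (M ⧸ (𝔪 • ⊤ : Submodule A M)) :=
    Module.Finite.of_restrictScalars_finite A _ _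
  let b := Module.finBasis (A ⧸ 𝔪) (M ⧸ (𝔪 • ⊤ : Submodule A M))
  choose w hw using fun j ↦ Submodule.mkQ_surjective (𝔪 • ⊤ : Submodule A M) (b j)
  have hspan : (Submodule.span A (Set.range w)).map (𝔪 • ⊤ : Submodule A M).mkQ = ⊤ := by
    rw [Submodule.map_span, ← Set.range_comp,
      show (𝔪 • ⊤ : Submodule A M).mkQ ∘ w = b from funext hw,
      ← Submodule.restrictScalars_span A (A ⧸ 𝔪) Ideal.Quotient.mk_surjective, b.span_eq,
      Submodule.restrictScalars_top]
  have hsup : ⊤ ≤ Submodule.span A (Set.range w) ⊔ 𝔪 • (⊤ : Submodule A M) := by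
    have h := congrArg (Submodule.comap (𝔪 • ⊤ : Submodule A M).mkQ) hspan
    rw [Submodule.comap_map_mkQ, Submodule.comap_top, sup_comm] at h
    exact h.ge
  obtain ⟨r, hr, hle⟩ := Submodule.exists_sub_one_mem_and_smul_le_of_fg_of_le_sup
    Module.Finite.fg_top le_rfl hsup
  refine ⟨w, r, fun hmem ↦ h𝔪.ne_top ((Ideal.eq_top_iff_one 𝔪).2 ?_),
    fun m ↦ hle (Submodule.smul_mem_pointwise_smul m r ⊤ trivial)⟩
  simpa using 𝔪.sub_mem hmem hr

/-- Let `A` be a commutative ring, `M` a finitely generated `A`-module and `i ≥ 1`.  Then the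
`i`-th exterior power `Λ^i M` vanishes (here `Λ^i M` is realized inside the exterior algebra
as the `i`-th power of the image submodule of `ι : M → Λ M`) if and only if for every maximal
ideal `𝔪` of `A` the `A/𝔪`-vector space `M/𝔪M` has dimension at most `i - 1`. -/
theorem exteriorPower_eq_bot_iff {A : Type*} [CommRing A] (M : Type*) [AddCommGroup M]
    [Module A M] [Module.Finite A M] (i : ℕ) (hi : 1 ≤ i) :
    (LinearMap.range (ExteriorAlgebra.ι A : M →ₗ[A] ExteriorAlgebra A M)) ^ i = ⊥ ↔
      ∀ (𝔪 : Ideal A), 𝔪.IsMaximal →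
        Module.finrank (A ⧸ 𝔪) (M ⧸ (𝔪 • ⊤ : Submodule A M)) ≤ i - 1 := by
  constructor
  · intro h 𝔪 h𝔪
    let _ := Ideal.Quotient.field 𝔪
    by_contra! hlt
    have hle : i ≤ Module.finrank (A ⧸ 𝔪) (M ⧸ (𝔪 • ⊤ : Submodule A M)) := by omega
    have : Module.Finite (A ⧸ 𝔪) (M ⧸ (𝔪 • ⊤ : Submodule A M)) :=
      Module.Finite.of_restrictScalars_finite A _ _
    let b := Module.finBasis (A ⧸ 𝔪) (M ⧸ (𝔪 • ⊤ : Submodule A M))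
    let p := LinearMap.funLeft (A ⧸ 𝔪) (A ⧸ 𝔪) (Fin.castLE hle) ∘ₗ b.equivFun.toLinearMap
    have hp : Function.Surjective p :=
      (LinearMap.funLeft_surjective_of_injective (A ⧸ 𝔪) (A ⧸ 𝔪) _ (Fin.castLE_injective hle)).comp
        b.equivFun.surjective
    exact exteriorPower_ne_bot_of_surjective
      (p.restrictScalars A ∘ₗ (𝔪 • ⊤ : Submodule A M).mkQ)
      (hp.comp (Submodule.mkQ_surjective _)) h
  · intro h
    change ⋀[A]^i M = ⊥
    rw [← ExteriorAlgebra.ιMulti_span_fixedDegree, Submodule.span_eq_bot]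
    rintro _ ⟨v, rfl⟩
    by_contra hv
    obtain ⟨𝔪, h𝔪, hle⟩ := Ideal.exists_le_maximal
      (Ideal.torsionOf A _ (ExteriorAlgebra.ιMulti A i v))
      ((Ideal.torsionOf_eq_top_iff A _).not.2 hv)
    obtain ⟨w, r, hr, hmem⟩ := h𝔪.exists_notMem_smul_mem_span (M := M)
    have hlt := h 𝔪 h𝔪
    exact hr (h𝔪.isPrime.mem_of_pow_mem i (hle
      (AlternatingMap.pow_smul_eq_zero (by omega) hmem (ExteriorAlgebra.ιMulti A i) v)))
end

section
/- Let k be a field and let (A, \mathfrak{m}) be a Noetherian local ring which is a k-algebra such that the composite k \to A \to A/\mathfrak{m} is an isomorphism (i.e. A has residue field k). Let K be a field extension of k. Let f, g \in A \otimes_k K be elements such that f \ne 0 and the image of g under the natural map A \otimes_k K \to (A/\mathfrak{m}) \otimes_k K \cong K is nonzero. Then g^s f \ne 0 in A \otimes_k K for every natural number s. -/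
open TensorProduct

/-- If `k → B` is surjective, every element of `B ⊗[k] K` is of the form `1 ⊗ₜ c`. -/
theorem exists_one_tmul_eq_of_surjective {k K B : Type*} [CommRing k] [CommRing K] [Algebra k K]
    [CommRing B] [Algebra k B] (h : Function.Surjective (algebraMap k B)) (x : B ⊗[k] K) :
    ∃ c : K, (1 : B) ⊗ₜ[k] c = x := by
  induction x using TensorProduct.induction_on with
  | zero => exact ⟨0, TensorProduct.tmul_zero _ _⟩
  | tmul b y =>
    obtain ⟨r, rfl⟩ := h b
    exact ⟨r • y, by rw [← TensorProduct.smul_tmul, Algebra.algebraMap_eq_smul_one]⟩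
  | add x y hx hy =>
    obtain ⟨c, rfl⟩ := hx
    obtain ⟨d, rfl⟩ := hy
    exact ⟨c + d, TensorProduct.tmul_add _ _ _⟩

/-- A linear functional sends the extension of an ideal `I` to an algebra into `I`. -/
theorem LinearMap.apply_mem_of_mem_ideal_map {A B : Type*} [CommRing A] [CommRing B] [Algebra A B]
    (φ : B →ₗ[A] A) {I : Ideal A} {x : B} (hx : x ∈ I.map (algebraMap A B)) : φ x ∈ I := by
  have hx' : x ∈ I • (⊤ : Submodule A B) := by
    rw [Ideal.smul_top_eq_map]
    exact hx
  clear hx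
  induction hx' using Submodule.smul_induction_on' with
  | smul a ha y _ =>
    rw [map_smul, smul_eq_mul]
    exact Ideal.mul_mem_right _ _ ha
  | add x _ y _ hx hy =>
    rw [map_add]
    exact I.add_mem hx hy

/-- In a free algebra over a Noetherian local ring `A`, an element fixed by multiplication by
an element of the extension of the maximal ideal vanishes. -/
theorem Module.Basis.eq_zero_of_eq_mul_of_mem_map_maximalIdeal {ι A B : Type*} [CommRing A]
    [IsNoetherianRing A] [IsLocalRing A] [CommRing B] [Algebra A B] (b : Module.Basis ι A B)
    {f h : B} (hh : h ∈ (IsLocalRing.maximalIdeal A).map (algebraMap A B)) (hf : f = h * f) :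
    f = 0 := by
  have hpow (n : ℕ) : f = h ^ n * f := by
    induction n with
    | zero => simp
    | succ n ih => rw [pow_succ, mul_assoc, ← hf, ← ih]
  refine b.ext_elem fun i ↦ ?_
  have hmem : b.coord i f ∈ ⨅ n : ℕ, IsLocalRing.maximalIdeal A ^ n := by
    refine (Ideal.mem_iInf).2 fun n ↦ (b.coord i).apply_mem_of_mem_ideal_map ?_
    rw [Ideal.map_pow, hpow n]
    exact Ideal.mul_mem_right _ _ (Ideal.pow_mem_pow hh n)
  rw [Ideal.iInf_pow_eq_bot_of_isLocalRing _ (IsLocalRing.maximalIdeal.isMaximal A).ne_top] at hmem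
  simpa using hmem

/-- Let `k` be a field, `(A, 𝔪)` a Noetherian local `k`-algebra whose residue field is `k`
(i.e. the composite `k → A → A/𝔪` is an isomorphism), and `K` a field extension of `k`.
If `f, g ∈ A ⊗_k K` are such that `f ≠ 0` and the image of `g` under the natural map
`A ⊗_k K → (A/𝔪) ⊗_k K (≅ K)` is nonzero, then `g^s * f ≠ 0` in `A ⊗_k K` for every
natural number `s`. -/
theorem pow_mul_ne_zero_of_residue_ne_zero (k K A : Type*) [Field k] [Field K] [Algebra k K]
    [CommRing A] [Algebra k A] [IsNoetherianRing A] [IsLocalRing A]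
    (hres : Function.Bijective (algebraMap k (A ⧸ IsLocalRing.maximalIdeal A)))
    (f g : A ⊗[k] K) (hf : f ≠ 0)
    (hg : Algebra.TensorProduct.map
        (Ideal.Quotient.mkₐ k (IsLocalRing.maximalIdeal A)) (AlgHom.id k K) g ≠ 0)
    (s : ℕ) : g ^ s * f ≠ 0 := by
  have hreg (f : A ⊗[k] K) (hgf : g * f = 0) : f = 0 := by
    obtain ⟨c, hc⟩ := exists_one_tmul_eq_of_surjective hres.2 (Algebra.TensorProduct.map
      (Ideal.Quotient.mkₐ k (IsLocalRing.maximalIdeal A)) (AlgHom.id k K) g)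
    have hc0 : c ≠ 0 := by
      rintro rfl
      exact hg (by rw [← hc, TensorProduct.tmul_zero])
    have hker : (1 : A) ⊗ₜ[k] c - g ∈
        (IsLocalRing.maximalIdeal A).map (algebraMap A (A ⊗[k] K)) := by
      have hmem : (1 : A) ⊗ₜ[k] c - g ∈ RingHom.ker (Algebra.TensorProduct.map
          (Ideal.Quotient.mkₐ k (IsLocalRing.maximalIdeal A)) (AlgHom.id k K)) := by
        rw [RingHom.mem_ker, map_sub, ← hc, Algebra.TensorProduct.map_tmul, map_one,
          AlgHom.id_apply, sub_self]
      rw [Algebra.TensorProduct.rTensor_ker _ (Ideal.Quotient.mkₐ_surjective k _),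
        show RingHom.ker (Ideal.Quotient.mkₐ k (IsLocalRing.maximalIdeal A)) = _ from
          Ideal.mk_ker] at hmem
      exact hmem
    refine (Algebra.TensorProduct.basis A
      (Module.Basis.ofVectorSpace k K)).eq_zero_of_eq_mul_of_mem_map_maximalIdeal
      (Ideal.mul_mem_left _ ((1 : A) ⊗ₜ[k] c⁻¹) hker) ?_
    rw [mul_assoc, sub_mul, hgf, sub_zero, ← mul_assoc, Algebra.TensorProduct.tmul_mul_tmul,
      inv_mul_cancel₀ hc0, mul_one, ← Algebra.TensorProduct.one_def, one_mul]
  induction s with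
  | zero => simpa using hf
  | succ s ih =>
    rw [pow_succ', mul_assoc]
    exact fun h ↦ ih (hreg _ h)
end

section
/- Let (A, \mathfrak{m}) be a local ring, let \phi : A^s \to A^t be an A-module homomorphism, and let \psi : (A/\mathfrak{m})^s \to (A/\mathfrak{m})^t be the reduction of \phi modulo \mathfrak{m}. If the rank of the linear map \psi over the field A/\mathfrak{m} is at least r, then there exist indices i_1 < i_2 < \cdots < i_r in \{1, ..., t\} such that the composition of \phi with the projection A^t \to A^r onto the coordinates i_1, ..., i_r is surjective; in particular there is a surjective A-linear map from A^s/\ker(\phi) onto the free module A^r (so the (r-1)-st Fitting ideal of A^s/\ker(\phi) is zero). -/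
open IsLocalRing

/-- Over a field, a matrix of rank at least `r` has `r` linearly independent rows, which can be
listed in increasing order. -/
theorem Matrix.exists_strictMono_linearIndependent_row {K m : Type*} [Field K] [Fintype m]
    {t r : ℕ} (M : Matrix (Fin t) m K) (h : r ≤ M.rank) :
    ∃ σ : Fin r → Fin t, StrictMono σ ∧ LinearIndependent K (M.row ∘ σ) := by
  obtain ⟨κ, a, ha, hspan, hli⟩ := exists_linearIndependent' K M.row
  have : Finite κ := Finite.of_injective a ha
  have : Fintype κ := Fintype.ofFinite κ
  have hcard : r ≤ (Finset.univ.image a).card := by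
    rw [Finset.card_image_of_injective _ ha, Finset.card_univ, ← finrank_span_eq_card hli, hspan,
      ← M.rank_eq_finrank_span_row]
    exact h
  obtain ⟨u, hu, hur⟩ := Finset.exists_subset_card_eq hcard
  refine ⟨u.orderEmbOfFin hur, (u.orderEmbOfFin hur).strictMono, ?_⟩
  have hmem : ∀ i, ∃ k, a k = u.orderEmbOfFin hur i := fun i => by
    simpa using hu (u.orderEmbOfFin_mem hur i)
  choose b hb using hmem
  have hbinj : Function.Injective b := fun i j hij =>
    (u.orderEmbOfFin hur).injective (by rw [← hb, ← hb, hij])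
  have hcomp : M.row ∘ u.orderEmbOfFin hur = (M.row ∘ a) ∘ b := by
    ext i : 1
    simp [hb]
  rw [hcomp]
  exact hli.comp b hbinj

/-- Over a field, a linear map of rank at least `r` becomes surjective after projecting onto
suitable `r` coordinates. -/
theorem LinearMap.exists_strictMono_funLeft_comp_surjective {K : Type*} [Field K] {s t r : ℕ}
    (ψ : (Fin s → K) →ₗ[K] (Fin t → K)) (h : r ≤ Module.finrank K (LinearMap.range ψ)) :
    ∃ σ : Fin r → Fin t, StrictMono σ ∧
      Function.Surjective ((LinearMap.funLeft K K σ).comp ψ) := by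
  have hrank : r ≤ (LinearMap.toMatrix' ψ).rank := by
    rwa [Matrix.rank, ← Matrix.toLin'_apply', Matrix.toLin'_toMatrix']
  obtain ⟨σ, hσ, hli⟩ := Matrix.exists_strictMono_linearIndependent_row _ hrank
  refine ⟨σ, hσ, ?_⟩
  have hsub : ((LinearMap.toMatrix' ψ).submatrix σ _root_.id).mulVecLin =
      (LinearMap.funLeft K K σ).comp ψ := by
    refine LinearMap.ext fun x => funext fun i => ?_
    exact congrFun (LinearMap.toMatrix'_mulVec ψ x) (σ i)
  have hr : ((LinearMap.toMatrix' ψ).submatrix σ _root_.id).rank = Fintype.card (Fin r) :=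
    LinearIndependent.rank_matrix hli
  rw [← hsub, ← LinearMap.range_eq_top]
  apply Submodule.eq_top_of_finrank_eq
  rw [← Matrix.rank, hr, Module.finrank_fintype_fun_eq_card]

/-- A linear map to a finite free module over a local ring is surjective as soon as its image
contains, modulo the maximal ideal, the standard basis. -/
theorem IsLocalRing.surjective_of_residue_eq_single {A M ι : Type*} [CommRing A] [IsLocalRing A]
    [AddCommGroup M] [Module A M] [Fintype ι] [DecidableEq ι] (f : M →ₗ[A] (ι → A)) (x : ι → M)
    (hx : ∀ k j, residue A (f (x k) j) = (Pi.single k 1 : ι → ResidueField A) j) :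
    Function.Surjective f := by
  let B : Matrix ι ι A := Matrix.of fun j k => f (x k) j
  have hB : (residue A).mapMatrix B = 1 := by
    ext j k
    simp [B, hx, Matrix.one_apply, Pi.single_apply]
  have hdet : IsUnit B.det := by
    rw [← isUnit_map_iff (residue A), RingHom.map_det, hB, Matrix.det_one]
    exact isUnit_one
  intro y
  refine ⟨∑ k, (B⁻¹.mulVec y) k • x k, ?_⟩
  calc f (∑ k, (B⁻¹.mulVec y) k • x k) = B.mulVec (B⁻¹.mulVec y) := by
        ext j
        simp [B, Matrix.mulVec, dotProduct, Finset.sum_apply, mul_comm]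
    _ = y := by rw [Matrix.mulVec_mulVec, Matrix.mul_nonsing_inv B hdet, Matrix.one_mulVec]

/-- Let `(A, 𝔪)` be a local ring, `φ : A^s → A^t` an `A`-linear map and
`ψ : (A/𝔪)^s → (A/𝔪)^t` its reduction modulo `𝔪` (expressed by the compatibility
hypothesis `hψ`).  If the rank of `ψ` over the field `A/𝔪` is at least `r`, then there are
indices `i_1 < i_2 < ⋯ < i_r` in `{1, …, t}` (encoded by a strictly monotone
`σ : Fin r → Fin t`) such that the composition of `φ` with the projection `A^t → A^r` onto
the coordinates `i_1, …, i_r` is surjective; in particular there is a surjective `A`-linear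
map from `A^s / ker φ` onto the free module `A^r`. -/
theorem projection_comp_surjective_of_residue_rank_le {A : Type*} [CommRing A] [IsLocalRing A]
    (s t r : ℕ) (φ : (Fin s → A) →ₗ[A] (Fin t → A))
    (ψ : (Fin s → ResidueField A) →ₗ[ResidueField A] (Fin t → ResidueField A))
    (hψ : ∀ x : Fin s → A,
      ψ (fun i => residue A (x i)) = fun j => residue A (φ x j))
    (hrank : r ≤ Module.finrank (ResidueField A) (LinearMap.range ψ)) :
    ∃ σ : Fin r → Fin t, StrictMono σ ∧
      Function.Surjective ((LinearMap.funLeft A A σ).comp φ) ∧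
      ∃ π : ((Fin s → A) ⧸ LinearMap.ker φ) →ₗ[A] (Fin r → A), Function.Surjective π := by
  obtain ⟨σ, hσ, hsurj⟩ := ψ.exists_strictMono_funLeft_comp_surjective hrank
  have hlift : ∀ k : Fin r, ∃ x : Fin s → A, ∀ j,
      residue A (φ x (σ j)) = (Pi.single k 1 : Fin r → ResidueField A) j := fun k => by
    obtain ⟨z, hz⟩ := hsurj (Pi.single k 1)
    choose x hx using fun i => residue_surjective (z i)
    obtain rfl : (fun i => residue A (x i)) = z := funext hx
    refine ⟨x, fun j => ?_⟩
    rw [← hz, LinearMap.comp_apply, hψ, LinearMap.funLeft_apply]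
  choose x hx using hlift
  have hsurj' : Function.Surjective ((LinearMap.funLeft A A σ).comp φ) :=
    surjective_of_residue_eq_single _ x hx
  refine ⟨σ, hσ, hsurj', (LinearMap.ker φ).liftQ
    ((LinearMap.funLeft A A σ).comp φ) (LinearMap.ker_le_ker_comp _ _), ?_⟩
  rw [← LinearMap.range_eq_top, Submodule.range_liftQ]
  exact LinearMap.range_eq_top.mpr hsurj'
end

section
/- Let (A, \mathfrak{m}) be a local ring and g : A^n \to A^N an A-module homomorphism with kernel K = \ker(g), and suppose the quotient A^n/K is a free A-module of rank l. Let p : A^N \to A^l be the projection onto some choice of l coordinates, and suppose that the reduction modulo \mathfrak{m} of the composition p \circ g, namely the induced map (A/\mathfrak{m})^n \to (A/\mathfrak{m})^l, is surjective. Then p \circ g : A^n \to A^l is surjective and \ker(p \circ g) = K. -/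
open IsLocalRing

/-- A vector whose coordinates all lie in an ideal `I` lies in `I • ⊤`. -/
lemma mem_ideal_smul_top_of_forall_apply_mem {R ι : Type*} [CommRing R] [Finite ι] {I : Ideal R}
    {x : ι → R} (hx : ∀ i, x i ∈ I) : x ∈ I • (⊤ : Submodule R (ι → R)) := by
  classical
  have := Fintype.ofFinite ι
  rw [pi_eq_sum_univ x]
  exact Submodule.sum_mem _ fun i _ ↦ Submodule.smul_mem_smul (hx i) Submodule.mem_top

/-- A linear map into a finite free module over a local ring is surjective if every vector is
congruent, modulo the maximal ideal, to one in its range. -/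
lemma LinearMap.surjective_of_forall_exists_residue_eq {R M ι : Type*} [CommRing R]
    [IsLocalRing R] [AddCommGroup M] [Module R M] [Finite ι] (f : M →ₗ[R] ι → R)
    (hf : ∀ y : ι → R, ∃ x, ∀ i, residue R (f x i) = residue R (y i)) :
    Function.Surjective f := by
  rw [← LinearMap.range_eq_top, ← top_le_iff]
  refine Submodule.le_of_le_smul_of_le_jacobson_bot (I := maximalIdeal R) Module.Finite.fg_top
    (maximalIdeal_le_jacobson ⊥) fun y _ ↦ ?_
  obtain ⟨x, hx⟩ := hf y
  have hy : y - f x ∈ maximalIdeal R • (⊤ : Submodule R (ι → R)) :=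
    mem_ideal_smul_top_of_forall_apply_mem fun i ↦ by
      rw [← residue_eq_zero_iff, Pi.sub_apply, map_sub, hx, sub_self]
  exact Submodule.mem_sup.mpr ⟨f x, f.mem_range_self x, y - f x, hy, add_sub_cancel _ _⟩

/-- If `f : M → F` is surjective and kills a submodule `K` with `M ⧸ K ≃ F` finite, then
`ker f = K`. -/
lemma LinearMap.ker_eq_of_surjective_of_quotient_equiv {R M F : Type*} [CommRing R]
    [AddCommGroup M] [Module R M] [AddCommGroup F] [Module R F] [Module.Finite R F]
    {K : Submodule R M} (e : (M ⧸ K) ≃ₗ[R] F) {f : M →ₗ[R] F} (hK : K ≤ LinearMap.ker f)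
    (hf : Function.Surjective f) : LinearMap.ker f = K := by
  have hlift : Function.Surjective (K.liftQ f hK) := by
    rw [← LinearMap.range_eq_top, Submodule.range_liftQ, LinearMap.range_eq_top.mpr hf]
  have := Module.Finite.equiv e.symm
  have hinj : Function.Injective (K.liftQ f hK) :=
    OrzechProperty.injective_of_surjective_of_injective e.toLinearMap _ e.injective hlift
  refine le_antisymm (fun x hx ↦ ?_) hK
  rw [← Submodule.Quotient.mk_eq_zero]
  exact hinj (by simpa using hx)

/-- Let `(A, 𝔪)` be a local ring and `g : A^n → A^N` an `A`-linear map with kernel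
`K = ker g` such that `A^n / K` is a free `A`-module of rank `l`.  Let `p : A^N → A^l` be
the projection onto some choice of `l` coordinates (encoded by an injective
`σ : Fin l → Fin N`), and suppose that the reduction modulo `𝔪` of `p ∘ g`, namely the
induced map `(A/𝔪)^n → (A/𝔪)^l` (expressed by the compatibility hypothesis `hψ`), is
surjective.  Then `p ∘ g : A^n → A^l` is surjective and `ker (p ∘ g) = K`. -/
theorem proj_comp_surjective_and_ker_eq {A : Type*} [CommRing A] [IsLocalRing A]
    (n N l : ℕ) (g : (Fin n → A) →ₗ[A] (Fin N → A))
    (hfree : Nonempty (((Fin n → A) ⧸ LinearMap.ker g) ≃ₗ[A] (Fin l → A)))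
    (σ : Fin l → Fin N) (hσ : Function.Injective σ)
    (ψ : (Fin n → ResidueField A) →ₗ[ResidueField A] (Fin l → ResidueField A))
    (hψ : ∀ x : Fin n → A,
      ψ (fun i => residue A (x i)) = fun j => residue A (((LinearMap.funLeft A A σ).comp g) x j))
    (hsurj : Function.Surjective ψ) :
    Function.Surjective ((LinearMap.funLeft A A σ).comp g) ∧
      LinearMap.ker ((LinearMap.funLeft A A σ).comp g) = LinearMap.ker g := by
  have hs : Function.Surjective ((LinearMap.funLeft A A σ).comp g) := by
    refine LinearMap.surjective_of_forall_exists_residue_eq _ fun y ↦ ?_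
    obtain ⟨z, hz⟩ := hsurj fun j ↦ residue A (y j)
    choose x hx using fun i ↦ residue_surjective (z i)
    refine ⟨x, fun j ↦ ?_⟩
    rw [← congrFun (hψ x) j, funext hx, hz]
  obtain ⟨e⟩ := hfree
  exact ⟨hs, LinearMap.ker_eq_of_surjective_of_quotient_equiv e (LinearMap.ker_le_ker_comp g _) hs⟩
end

section
/- Let k be a field, A a commutative k-algebra, n \ge 0, and S_A = A[x_0, ..., x_n] with S_{A,d} its degree-d homogeneous component. Let J_R \subseteq S_{A,R} and J_{R+1} \subseteq S_{A,R+1} be A-submodules. Let K = k(a_0, ..., a_n) be the field of rational functions in n+1 indeterminates and let L = a_0 x_0 + \cdots + a_n x_n, the generic linear form. If multiplication by L maps J_R \otimes_k K into J_{R+1} \otimes_k K (both regarded as submodules of S_{A \otimes_k K, R+1} via flatness of K over k), then x_i \cdot J_R \subseteq J_{R+1} for every i \in \{0, ..., n\}; in particular S_1 \cdot J_R \subseteq J_{R+1}. -/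
open MvPolynomial TensorProduct

namespace MvPolynomial

variable {k K A σ : Type*} [Field k] [CommRing K] [Algebra k K] [CommRing A] [Algebra k A]

/-- The coefficientwise contraction `A_K[x] → A[x]` induced by a `k`-linear functional on `K`. -/
noncomputable def contract (l : K →ₗ[k] k) : MvPolynomial σ (K ⊗[k] A) →+ MvPolynomial σ A where
  toFun := AddMonoidAlgebra.map
    ((TensorProduct.lid k A).toLinearMap ∘ₗ l.rTensor A).toAddMonoidHom
  map_zero' := by
    ext d
    exact map_zero ((TensorProduct.lid k A).toLinearMap ∘ₗ l.rTensor A)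
  map_add' p q := by
    ext d
    exact map_add ((TensorProduct.lid k A).toLinearMap ∘ₗ l.rTensor A) (coeff d p) (coeff d q)

theorem coeff_contract (l : K →ₗ[k] k) (p : MvPolynomial σ (K ⊗[k] A)) (d : σ →₀ ℕ) :
    coeff d (contract l p) = TensorProduct.lid k A (l.rTensor A (coeff d p)) :=
  rfl

theorem contract_smul (l : K →ₗ[k] k) (c : K) (p : MvPolynomial σ (K ⊗[k] A)) :
    contract l (c • p) = contract (l ∘ₗ LinearMap.mulLeft k c) p := by
  ext d
  rw [coeff_contract, coeff_contract, coeff_smul]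
  induction coeff d p using TensorProduct.induction_on with
  | zero => simp
  | tmul x a => simp [TensorProduct.smul_tmul']
  | add x y hx hy => simp only [smul_add, map_add, hx, hy]

theorem contract_map_includeRight (l : K →ₗ[k] k) (p : MvPolynomial σ A) :
    contract l (map (Algebra.TensorProduct.includeRight : A →ₐ[k] K ⊗[k] A).toRingHom p) =
      C (algebraMap k A (l 1)) * p := by
  ext d
  rw [coeff_contract, coeff_map, coeff_C_mul]
  simp [Algebra.smul_def]

theorem contract_mem_of_mem_span {J : Submodule A (MvPolynomial σ A)}
    {p : MvPolynomial σ (K ⊗[k] A)}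
    (hp : p ∈ Submodule.span K
      (map (Algebra.TensorProduct.includeRight : A →ₐ[k] K ⊗[k] A).toRingHom '' (J : Set _)))
    (l : K →ₗ[k] k) : contract l p ∈ J := by
  induction hp using Submodule.span_induction generalizing l with
  | mem p hp =>
    obtain ⟨g, hg, rfl⟩ := hp
    rw [contract_map_includeRight, ← smul_eq_C_mul]
    exact J.smul_mem _ hg
  | zero => simp
  | add p q _ _ hp hq => simpa only [map_add] using J.add_mem (hp l) (hq l)
  | smul c p _ hp => simpa only [contract_smul] using hp _

theorem contract_linearForm_mul [Fintype σ] (l : K →ₗ[k] k) (c : σ → K) (p : MvPolynomial σ A) :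
    contract l ((∑ i, C (algebraMap K (K ⊗[k] A) (c i)) * X i) *
        map (Algebra.TensorProduct.includeRight : A →ₐ[k] K ⊗[k] A).toRingHom p) =
      ∑ i, C (algebraMap k A (l (c i))) * (X i * p) := by
  rw [Finset.sum_mul, map_sum]
  refine Finset.sum_congr rfl fun i _ => ?_
  have h : C (algebraMap K (K ⊗[k] A) (c i)) * X i *
      map (Algebra.TensorProduct.includeRight : A →ₐ[k] K ⊗[k] A).toRingHom p =
      c i • map (Algebra.TensorProduct.includeRight : A →ₐ[k] K ⊗[k] A).toRingHom (X i * p) := by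
    rw [algebra_compatible_smul (K ⊗[k] A) (c i), smul_eq_C_mul, map_mul, map_X, mul_assoc]
  rw [h, contract_smul, contract_map_includeRight]
  simp

/-- If multiplication by a linear form with `k`-linearly independent coefficients in `K` maps
`J ⊗ K` into `J' ⊗ K`, then multiplication by each variable maps `J` into `J'`. -/
theorem X_mul_mem_of_linearForm_mul_mem_span [Fintype σ] {c : σ → K}
    (hc : LinearIndependent k c) {J : Submodule A (MvPolynomial σ A)} {p : MvPolynomial σ A}
    (hp : (∑ i, C (algebraMap K (K ⊗[k] A) (c i)) * X i) *
        map (Algebra.TensorProduct.includeRight : A →ₐ[k] K ⊗[k] A).toRingHom p ∈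
      Submodule.span K
        (map (Algebra.TensorProduct.includeRight : A →ₐ[k] K ⊗[k] A).toRingHom '' (J : Set _)))
    (i : σ) : X i * p ∈ J := by
  classical
  obtain ⟨l, hl⟩ := ((Finsupp.lapply i).comp hc.repr).exists_extend
  have hlc (j : σ) : l (c j) = if j = i then 1 else 0 := by
    have h := LinearMap.congr_fun hl ⟨c j, Submodule.subset_span ⟨j, rfl⟩⟩
    rw [LinearMap.comp_apply, LinearMap.comp_apply, hc.repr_eq_single j _ rfl] at h
    simpa [Finsupp.single_apply] using h
  have h := contract_mem_of_mem_span hp l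
  rw [contract_linearForm_mul] at h
  simpa [hlc] using h

end MvPolynomial

theorem linearIndependent_algebraMap_X (k σ : Type*) [Field k] :
    LinearIndependent k fun i : σ =>
      algebraMap (MvPolynomial σ k) (FractionRing (MvPolynomial σ k)) (X i) :=
  (linearIndependent_X σ k).map_injOn
    (IsScalarTower.toAlgHom k (MvPolynomial σ k) (FractionRing (MvPolynomial σ k))).toLinearMap
    (IsFractionRing.injective _ _).injOn

set_option synthInstance.maxHeartbeats 1000000 in
set_option maxHeartbeats 1000000 in
/-- Let `k` be a field, `A` a commutative `k`-algebra, `S_A = A[x_0, …, x_n]` with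
`S_{A,d}` its degree-`d` homogeneous component, and let `J_R ⊆ S_{A,R}`,
`J_{R+1} ⊆ S_{A,R+1}` be `A`-submodules.  Let `K = k(a_0, …, a_n)` be the field of rational
functions in `n+1` indeterminates (the fraction field of `k[a_0, …, a_n]`) and let
`L = a_0 x_0 + ⋯ + a_n x_n` be the generic linear form.  If multiplication by `L` maps
`J_R ⊗_k K` into `J_{R+1} ⊗_k K` — both regarded inside `S_{A ⊗_k K, R+1}`, where
`J ⊗_k K` is identified (by flatness of `K` over `k`) with the `K`-span of the image of `J`
— then `x_i · J_R ⊆ J_{R+1}` for every `i ∈ {0, …, n}`; in particular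
`S_1 · J_R ⊆ J_{R+1}`. -/
theorem mul_generic_linear_form_descends (k : Type*) [Field k] (A : Type*) [CommRing A]
    [Algebra k A] (n R : ℕ)
    (JR JR1 : Submodule A (MvPolynomial (Fin (n + 1)) A))
    (hJR : JR ≤ homogeneousSubmodule (Fin (n + 1)) A R)
    (hJR1 : JR1 ≤ homogeneousSubmodule (Fin (n + 1)) A (R + 1))
    (hL : ∀ f ∈ JR,
      (∑ i : Fin (n + 1),
          C (algebraMap (FractionRing (MvPolynomial (Fin (n + 1)) k))
              ((FractionRing (MvPolynomial (Fin (n + 1)) k)) ⊗[k] A)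
            (algebraMap (MvPolynomial (Fin (n + 1)) k)
              (FractionRing (MvPolynomial (Fin (n + 1)) k)) (X i))) * X i) *
        (MvPolynomial.map
          (Algebra.TensorProduct.includeRight :
            A →ₐ[k] (FractionRing (MvPolynomial (Fin (n + 1)) k)) ⊗[k] A).toRingHom f) ∈
      Submodule.span (FractionRing (MvPolynomial (Fin (n + 1)) k))
        ((MvPolynomial.map
          (Algebra.TensorProduct.includeRight :
            A →ₐ[k] (FractionRing (MvPolynomial (Fin (n + 1)) k)) ⊗[k] A).toRingHom) ''
          (JR1 : Set (MvPolynomial (Fin (n + 1)) A)))) :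
    ∀ i : Fin (n + 1), ∀ f ∈ JR, X i * f ∈ JR1 := by
  exact fun i f hf =>
    X_mul_mem_of_linearForm_mul_mem_span (linearIndependent_algebraMap_X k _) (hL f hf) i
end
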